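/- Assume b ∉ ℤ. Then the only subspaces of N that are invariant under all the b-twisted operators Ẽ_{ij}(n) (i,j ∈ {1,2}, n ∈ ℤ²), D̃1, D̃2 are {0} and N if and only if b + μ ∉ ℤ. (Equivalently: the twisted localization 𝒟_m^b M is an irreducible module over \widehat{gl_2(ℂ_q)} if and only if b + μ ∉ ℤ.) -/

import Mathlib

open MvPolynomial Finsupp

/-- The index set of the variables other than `x_m`. -/
abbrev NVar (m : ℤ × ℤ) := {p : ℤ × ℤ // p ≠ m}

/-- `N = ℂ[x_m, x_m^{−1}][x_n : n ≠ m]`, realized as finitely supported families,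
indexed by the exponent of `x_m` (an arbitrary integer), of polynomials in the
variables `x_n`, `n ≠ m`. -/
abbrev NN (m : ℤ × ℤ) := ℤ →₀ MvPolynomial (NVar m) ℂ

/-- Multiplication by `x_m^j` on `N` (for `j = -1` this is `X_m^{−1}`). -/
noncomputable def XmZ (m : ℤ × ℤ) (j : ℤ) (g : NN m) : NN m :=
  Finsupp.mapDomain (· + j) g

/-- Multiplication by `x_k` on `N` (the operator `X_k`). -/
noncomputable def Xop (m : ℤ × ℤ) (k : ℤ × ℤ) (g : NN m) : NN m :=
  if h : k = m then XmZ m 1 g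
  else Finsupp.mapRange (fun a => X (⟨k, h⟩ : NVar m) * a) (by simp) g

/-- The partial derivative `∂_s` on `N` (with `∂_m x_m^k = k x_m^{k−1}`, `k ∈ ℤ`). -/
noncomputable def Dop (m : ℤ × ℤ) (s : ℤ × ℤ) (g : NN m) : NN m :=
  if h : s = m then g.sum (fun k a => Finsupp.single (k - 1) (k • a))
  else Finsupp.mapRange (fun a => pderiv (⟨s, h⟩ : NVar m) a) (by simp) g

/-- A finite set of indices containing every `s` for which `∂_s` acts nonzero on `g`
(together with `m`); sums over all `s ∈ ℤ²` in the defining formulas reduce to sums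
over this finite set. -/
noncomputable def nvars (m : ℤ × ℤ) (g : NN m) : Finset (ℤ × ℤ) :=
  insert m (g.support.biUnion fun k => (g k).vars.image Subtype.val)

/-- `E21(n)` on `N`: multiplication by `x_n`. -/
noncomputable def E21N (m n : ℤ × ℤ) (g : NN m) : NN m := Xop m n g

/-- `E22(n) = Σ_s q^{s₁n₂} x_{n+s} ∂_s` on `N`. -/
noncomputable def E22N (q : ℂ) (m n : ℤ × ℤ) (g : NN m) : NN m :=
  ∑ s ∈ nvars m g, q ^ (s.1 * n.2) • Xop m (n + s) (Dop m s g)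

/-- `E11(n) = δ_{n,0} μ id − Σ_s q^{s₂n₁} x_{n+s} ∂_s` on `N`. -/
noncomputable def E11N (q μ : ℂ) (m n : ℤ × ℤ) (g : NN m) : NN m :=
  (if n = 0 then μ • g else 0) - ∑ s ∈ nvars m g, q ^ (s.2 * n.1) • Xop m (n + s) (Dop m s g)

/-- `E12(n) = q^{−n₁n₂} μ ∂_{−n} − Σ_{s,r} q^{n₂r₁+s₂n₁+s₂r₁} x_{n+s+r} ∂_s ∂_r` on `N`. -/
noncomputable def E12N (q μ : ℂ) (m n : ℤ × ℤ) (g : NN m) : NN m :=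
  q ^ (-(n.1 * n.2)) • μ • Dop m (-n) g -
    ∑ s ∈ nvars m g, ∑ r ∈ nvars m g,
      q ^ (n.2 * r.1 + s.2 * n.1 + s.2 * r.1) • Xop m (n + s + r) (Dop m s (Dop m r g))

/-- `𝓔_m = Σ_{s,r} q^{−m₂r₁−s₂m₁+s₂r₁} x_{−m+s+r} ∂_s ∂_r` on `N`. -/
noncomputable def EmN (q : ℂ) (m : ℤ × ℤ) (g : NN m) : NN m :=
  ∑ s ∈ nvars m g, ∑ r ∈ nvars m g,
    q ^ (-(m.2 * r.1) - s.2 * m.1 + s.2 * r.1) • Xop m (-m + s + r) (Dop m s (Dop m r g))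

/-- `D1 = Σ_s s₁ x_s ∂_s` on `N`. -/
noncomputable def D1N (m : ℤ × ℤ) (g : NN m) : NN m :=
  ∑ s ∈ nvars m g, (s.1 : ℂ) • Xop m s (Dop m s g)

/-- `D2 = Σ_s s₂ x_s ∂_s` on `N`. -/
noncomputable def D2N (m : ℤ × ℤ) (g : NN m) : NN m :=
  ∑ s ∈ nvars m g, (s.2 : ℂ) • Xop m s (Dop m s g)

/-- The `b`-twisted operator `Ẽ12(n)` on `N`. -/
noncomputable def tE12 (q μ : ℂ) (m : ℤ × ℤ) (b : ℂ) (n : ℤ × ℤ) (g : NN m) : NN m :=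
  E12N q μ m n g
    + b • (q ^ (m.2 * n.1) • E22N q m (m + n) (XmZ m (-1) g)
           - q ^ (m.1 * n.2) • E11N q μ m (m + n) (XmZ m (-1) g))
    - (b * (b - 1) * q ^ (m.2 * n.1 + m.2 * m.1 + m.1 * n.2)) •
        Xop m (m + m + n) (XmZ m (-1) (XmZ m (-1) g))

/-- The `b`-twisted operator `Ẽ11(n)` on `N`. -/
noncomputable def tE11 (q μ : ℂ) (m : ℤ × ℤ) (b : ℂ) (n : ℤ × ℤ) (g : NN m) : NN m :=
  E11N q μ m n g + (b * q ^ (m.2 * n.1)) • Xop m (m + n) (XmZ m (-1) g)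

/-- The `b`-twisted operator `Ẽ22(n)` on `N`. -/
noncomputable def tE22 (q : ℂ) (m : ℤ × ℤ) (b : ℂ) (n : ℤ × ℤ) (g : NN m) : NN m :=
  E22N q m n g - (b * q ^ (m.1 * n.2)) • Xop m (m + n) (XmZ m (-1) g)

/-- The `b`-twisted operator `D̃1 = D1 − b m₁ id` on `N`. -/
noncomputable def tD1 (m : ℤ × ℤ) (b : ℂ) (g : NN m) : NN m := D1N m g - (b * (m.1 : ℂ)) • g

/-- The `b`-twisted operator `D̃2 = D2 − b m₂ id` on `N`. -/
noncomputable def tD2 (m : ℤ × ℤ) (b : ℂ) (g : NN m) : NN m := D2N m g - (b * (m.2 : ℂ)) • g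

/-- Commuting operators `X k` and commuting operators `d s`, indexed by
`ℤ²`, satisfying the canonical commutation relations; on each vector only finitely many `d s` act
nontrivially. -/
structure WeylFamily (V : Type*) [AddCommGroup V] [Module ℂ V] where
  /-- the multiplication operators -/
  X : ℤ × ℤ → Module.End ℂ V
  /-- the differentiation operators -/
  d : ℤ × ℤ → Module.End ℂ V
  X_comm : ∀ k l, X k * X l = X l * X k
  d_comm : ∀ k l, d k * d l = d l * d k
  d_mul_X : ∀ s k, d s * X k = X k * d s + if s = k then 1 else 0
  finite : ∀ v, (Function.support fun s => d s v).Finite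

namespace WeylFamily

variable {V : Type*} [AddCommGroup V] [Module ℂ V] (w : WeylFamily V)

/-- The family of all derivatives of a vector. -/
noncomputable def dvec : V →ₗ[ℂ] (ℤ × ℤ →₀ V) where
  toFun v := Finsupp.ofSupportFinite (fun s => w.d s v) (w.finite v)
  map_add' a b := by ext s; simp [Finsupp.ofSupportFinite_coe]
  map_smul' c a := by ext s; simp [Finsupp.ofSupportFinite_coe]

/-- The locally finite sum `∑ s, Φ s ∘ d s`. -/
noncomputable def dsum (Φ : ℤ × ℤ → Module.End ℂ V) : Module.End ℂ V :=
  Finsupp.lsum ℂ Φ ∘ₗ w.dvec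

lemma dsum_apply (Φ : ℤ × ℤ → Module.End ℂ V) {v : V} {S : Finset (ℤ × ℤ)}
    (hS : ∀ s, s ∉ S → w.d s v = 0) : w.dsum Φ v = ∑ s ∈ S, Φ s (w.d s v) := by
  change (w.dvec v).sum (fun s => Φ s) = _
  rw [Finsupp.sum_of_support_subset (s := S)]
  · rfl
  · intro s hs
    by_contra h
    exact (Finsupp.mem_support_iff.mp hs) (hS s h)
  · simp

lemma exists_finset (v : V) : ∃ S : Finset (ℤ × ℤ), ∀ s, s ∉ S → w.d s v = 0 :=
  ⟨(w.finite v).toFinset, fun s hs => by simpa using hs⟩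

lemma exists_finset₂ (v v' : V) : ∃ S : Finset (ℤ × ℤ), (∀ s, s ∉ S → w.d s v = 0) ∧
    ∀ s, s ∉ S → w.d s v' = 0 := by
  classical
  obtain ⟨S, hS⟩ := w.exists_finset v
  obtain ⟨S', hS'⟩ := w.exists_finset v'
  exact ⟨S ∪ S', fun s hs => hS s fun h => hs (Finset.mem_union_left _ h),
    fun s hs => hS' s fun h => hs (Finset.mem_union_right _ h)⟩

lemma d_d (s r : ℤ × ℤ) (v : V) : w.d s (w.d r v) = w.d r (w.d s v) :=
  LinearMap.congr_fun (w.d_comm s r) v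

lemma X_X (s r : ℤ × ℤ) (v : V) : w.X s (w.X r v) = w.X r (w.X s v) :=
  LinearMap.congr_fun (w.X_comm s r) v

lemma d_X (s k : ℤ × ℤ) (v : V) : w.d s (w.X k v) = w.X k (w.d s v) + if s = k then v else 0 := by
  have := LinearMap.congr_fun (w.d_mul_X s k) v
  split_ifs with h <;> simpa [h] using this

lemma mul_dsum (A : Module.End ℂ V) (Φ : ℤ × ℤ → Module.End ℂ V) :
    A * w.dsum Φ = w.dsum fun s => A * Φ s := by
  ext v
  obtain ⟨S, hS⟩ := w.exists_finset v
  simp [w.dsum_apply _ hS]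

lemma dsum_add (Φ Ψ : ℤ × ℤ → Module.End ℂ V) :
    w.dsum (fun s => Φ s + Ψ s) = w.dsum Φ + w.dsum Ψ := by
  ext v
  obtain ⟨S, hS⟩ := w.exists_finset v
  simp [w.dsum_apply _ hS, Finset.sum_add_distrib]

lemma dsum_sub (Φ Ψ : ℤ × ℤ → Module.End ℂ V) :
    w.dsum (fun s => Φ s - Ψ s) = w.dsum Φ - w.dsum Ψ := by
  ext v
  obtain ⟨S, hS⟩ := w.exists_finset v
  simp [w.dsum_apply _ hS, Finset.sum_sub_distrib]

lemma dsum_smul (c : ℂ) (Φ : ℤ × ℤ → Module.End ℂ V) :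
    w.dsum (fun s => c • Φ s) = c • w.dsum Φ := by
  ext v
  obtain ⟨S, hS⟩ := w.exists_finset v
  simp [w.dsum_apply _ hS, Finset.smul_sum]

lemma dsum_mul_X (Φ : ℤ × ℤ → Module.End ℂ V) (k : ℤ × ℤ) :
    w.dsum Φ * w.X k = w.dsum (fun s => Φ s * w.X k) + Φ k := by
  classical
  ext v
  obtain ⟨S, hS, hS'⟩ := w.exists_finset₂ v (w.X k v)
  have hk : k ∉ S → v = 0 := by
    intro h
    have := hS' k h
    rwa [d_X, hS k h, map_zero, zero_add, if_pos rfl] at this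
  simp only [Module.End.mul_apply, LinearMap.add_apply]
  rw [w.dsum_apply _ hS, w.dsum_apply _ hS']
  simp only [d_X, map_add, Finset.sum_add_distrib, Module.End.mul_apply, add_right_inj]
  by_cases h : k ∈ S
  · rw [Finset.sum_eq_single k] <;> simp +contextual [h]
  · simp [hk h]

lemma dsum_mul_d (Φ : ℤ × ℤ → Module.End ℂ V) (k : ℤ × ℤ) :
    w.dsum Φ * w.d k = w.dsum fun s => Φ s * w.d k := by
  ext v
  obtain ⟨S, hS, hS'⟩ := w.exists_finset₂ v (w.d k v)
  simp [w.dsum_apply _ hS, w.dsum_apply _ hS', w.d_d _ k]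

lemma dsum_dsum_comm (A : ℤ × ℤ → ℤ × ℤ → Module.End ℂ V) :
    w.dsum (fun r => w.dsum (A r)) = w.dsum fun s => w.dsum fun r => A r s := by
  ext v
  obtain ⟨S, hS⟩ := w.exists_finset v
  have h' : ∀ r s, s ∉ S → w.d s (w.d r v) = 0 := fun r s hs => by rw [d_d, hS s hs, map_zero]
  simp only [w.dsum_apply _ hS, w.dsum_apply _ (h' _)]
  rw [Finset.sum_comm]
  refine Finset.sum_congr rfl fun s _ => Finset.sum_congr rfl fun r _ => ?_
  rw [w.d_d]

lemma dsum_ite (k : ℤ × ℤ) (A : Module.End ℂ V) :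
    w.dsum (fun s => if s = k then A else 0) = A * w.d k := by
  classical
  ext v
  obtain ⟨S, hS⟩ := w.exists_finset v
  rw [w.dsum_apply _ hS]
  by_cases h : k ∈ S
  · rw [Finset.sum_eq_single k] <;> simp +contextual [h]
  · rw [Finset.sum_eq_zero]
    · simp [hS k h]
    · rintro s hs
      rw [if_neg (by rintro rfl; exact h hs)]; rfl

/-- The first order operator `∑ s, ψ s • X (n + s) ∘ d s`. -/
noncomputable def first (ψ : ℤ × ℤ → ℂ) (n : ℤ × ℤ) : Module.End ℂ V :=
  w.dsum fun s => ψ s • w.X (n + s)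

/-- The second order operator `∑ s r, κ s r • X (n + s + r) ∘ d s ∘ d r`. -/
noncomputable def quad (κ : ℤ × ℤ → ℤ × ℤ → ℂ) (n : ℤ × ℤ) : Module.End ℂ V :=
  w.dsum fun r => w.dsum fun s => κ s r • w.X (n + s + r)

lemma first_mul_X (ψ : ℤ × ℤ → ℂ) (n k : ℤ × ℤ) :
    w.first ψ n * w.X k = w.X k * w.first ψ n + ψ k • w.X (n + k) := by
  rw [first, dsum_mul_X, mul_dsum]
  simp only [smul_mul_assoc, mul_smul_comm, w.X_comm _ k]

lemma quad_mul_X (κ : ℤ × ℤ → ℤ × ℤ → ℂ) (n k : ℤ × ℤ) :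
    w.quad κ n * w.X k = w.X k * w.quad κ n + w.first (κ k) (n + k)
      + w.first (fun s => κ s k) (n + k) := by
  rw [quad, dsum_mul_X, mul_dsum]
  simp only [dsum_mul_X, mul_dsum, smul_mul_assoc, mul_smul_comm, w.X_comm _ k, dsum_add, first,
    add_right_comm n _ k]

lemma quad_congr {κ κ' : ℤ × ℤ → ℤ × ℤ → ℂ} (n : ℤ × ℤ) (h : ∀ s r, κ s r = κ' s r) :
    w.quad κ n = w.quad κ' n := by
  rw [show κ = κ' from funext fun s => funext fun r => h s r]

lemma quad_symm (κ : ℤ × ℤ → ℤ × ℤ → ℂ) (n : ℤ × ℤ) :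
    w.quad κ n = w.quad (fun s r => κ r s) n := by
  rw [quad, dsum_dsum_comm, quad]
  simp only [add_right_comm n]

lemma first_mul_quad (ψ : ℤ × ℤ → ℂ) (κ : ℤ × ℤ → ℤ × ℤ → ℂ) (n a : ℤ × ℤ) :
    w.first ψ n * w.quad κ a = w.quad κ a * w.first ψ n
      + w.quad (fun s r => κ s r * ψ (a + s + r) - ψ s * κ (n + s) r - ψ r * κ s (n + r)) (n + a) := by
  have h1 : w.first ψ n * w.quad κ a =
      w.dsum (fun r => w.dsum fun s => κ s r • (w.X (a + s + r) * w.first ψ n))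
      + w.quad (fun s r => κ s r * ψ (a + s + r)) (n + a) := by
    rw [quad, mul_dsum]
    simp only [mul_dsum, mul_smul_comm, first_mul_X, smul_add, dsum_add, smul_smul, quad,
      ← add_assoc]
  have h2 : w.quad κ a * w.first ψ n =
      w.dsum (fun p => ψ p • (w.X (n + p) * w.quad κ a))
      + w.quad (fun s r => ψ s * κ (n + s) r + ψ r * κ s (n + r)) (n + a) := by
    have e : w.quad (fun s r => ψ s * κ (n + s) r + ψ r * κ s (n + r)) (n + a)
        = w.quad (fun s r => ψ r * κ (n + r) s) (n + a)
          + w.quad (fun s r => ψ r * κ s (n + r)) (n + a) := by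
      rw [w.quad_symm (fun s r => ψ r * κ (n + r) s)]
      simp only [quad, add_smul, dsum_add]
    rw [e, first, mul_dsum]
    simp only [mul_smul_comm, quad_mul_X, smul_add, dsum_add, add_assoc]
    simp only [first, quad, ← dsum_smul, smul_smul]
    simp only [show ∀ p s : ℤ × ℤ, a + (n + p) + s = n + a + s + p from fun p s => by abel]
  have h3 : w.dsum (fun r => w.dsum fun s => κ s r • (w.X (a + s + r) * w.first ψ n))
      = w.dsum (fun p => ψ p • (w.X (n + p) * w.quad κ a)) := by
    have e1 : w.dsum (fun r => w.dsum fun s => κ s r • (w.X (a + s + r) * w.first ψ n))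
        = w.dsum fun r => w.dsum fun s => w.dsum fun p =>
          (κ s r * ψ p) • (w.X (a + s + r) * w.X (n + p)) := by
      simp only [first, mul_dsum, mul_smul_comm, ← dsum_smul, smul_smul]
    have e2 : w.dsum (fun p => ψ p • (w.X (n + p) * w.quad κ a))
        = w.dsum fun p => w.dsum fun r => w.dsum fun s =>
          (κ s r * ψ p) • (w.X (a + s + r) * w.X (n + p)) := by
      simp only [quad, mul_dsum, mul_smul_comm, ← dsum_smul, smul_smul]
      simp only [w.X_comm (n + _), mul_comm]
    rw [e1, e2]
    symm
    rw [w.dsum_dsum_comm]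
    congr 1; funext r
    rw [w.dsum_dsum_comm]
  have h4 : w.quad (fun s r => κ s r * ψ (a + s + r) - ψ s * κ (n + s) r - ψ r * κ s (n + r)) (n + a)
      = w.quad (fun s r => κ s r * ψ (a + s + r)) (n + a)
        - w.quad (fun s r => ψ s * κ (n + s) r + ψ r * κ s (n + r)) (n + a) := by
    simp only [quad, sub_sub, sub_smul, dsum_sub]
  rw [h1, h2, h3, h4]
  abel

lemma d_mul_first (ψ : ℤ × ℤ → ℂ) (n k : ℤ × ℤ) :
    w.d k * w.first ψ n = w.first ψ n * w.d k + ψ (k - n) • w.d (k - n) := by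
  rw [first, mul_dsum, dsum_mul_d]
  simp only [mul_smul_comm, smul_mul_assoc, d_mul_X, smul_add, dsum_add, add_right_inj]
  rw [← one_mul (w.d (k - n)), ← smul_mul_assoc, ← dsum_ite]
  congr 1; funext s
  by_cases h : s = k - n
  · subst h; simp
  · have h' : k ≠ n + s := by rintro rfl; exact h (by abel)
    simp [h, h']

lemma d_mul_quad (κ : ℤ × ℤ → ℤ × ℤ → ℂ) (n k : ℤ × ℤ) :
    w.d k * w.quad κ n = w.quad κ n * w.d k
      + w.dsum (fun r => κ (k - n - r) r • w.d (k - n - r)) := by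
  rw [quad, mul_dsum, dsum_mul_d]
  simp only [mul_dsum, dsum_mul_d, mul_smul_comm, smul_mul_assoc, d_mul_X, smul_add, dsum_add,
    add_right_inj]
  congr 1; funext r
  rw [← one_mul (w.d (k - n - r)), ← smul_mul_assoc, ← dsum_ite]
  congr 1; funext s
  by_cases h : s = k - n - r
  · subst h
    simp [show n + (k - n - r) + r = k by abel]
  · have hk : k ≠ n + s + r := by rintro rfl; exact h (by abel)
    simp [h, hk]

/-- A third order operator in normal order. -/
noncomputable def cubic (c : ℤ × ℤ → ℤ × ℤ → ℤ × ℤ → ℂ) (n : ℤ × ℤ) : Module.End ℂ V :=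
  w.dsum fun r => w.dsum fun s => w.dsum fun p => c s r p • w.X (n + s + r + p)

lemma cubic_rotate (c : ℤ × ℤ → ℤ × ℤ → ℤ × ℤ → ℂ) (n : ℤ × ℤ) :
    w.cubic c n = w.cubic (fun s r p => c p s r) n := by
  rw [cubic, cubic, dsum_dsum_comm]
  rw [w.dsum_dsum_comm (fun r s => _)]
  rw [w.dsum_dsum_comm (fun r s => w.dsum fun p => c p s r • w.X (n + s + r + p))]
  congr 1; funext s
  rw [w.dsum_dsum_comm]
  congr 1; funext r
  congr 1; funext p
  rw [show n + p + s + r = n + s + r + p by abel]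

lemma quad_mul_quad (κ κ' : ℤ × ℤ → ℤ × ℤ → ℂ) (a n : ℤ × ℤ) :
    w.quad κ a * w.quad κ' n =
      w.dsum (fun r => w.dsum fun s => κ' s r • (w.X (n + s + r) * w.quad κ a))
      + w.cubic (fun s r p => κ' s r * κ (n + s + r) p) (a + n)
      + w.cubic (fun s r p => κ' s r * κ p (n + s + r)) (a + n) := by
  conv_lhs => rw [quad.eq_def w κ' n, mul_dsum]
  simp only [mul_dsum, mul_smul_comm, quad_mul_X, smul_add, dsum_add]
  simp only [first, cubic, ← dsum_smul, smul_smul, ← add_assoc]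

lemma quad_comm (κ κ' : ℤ × ℤ → ℤ × ℤ → ℂ) (a n : ℤ × ℤ)
    (h : ∀ s r p, κ' s r * κ (n + s + r) p = κ r p * κ' s (a + r + p))
    (h' : ∀ s r p, κ s r * κ' (a + s + r) p = κ' r p * κ s (n + r + p)) :
    w.quad κ a * w.quad κ' n = w.quad κ' n * w.quad κ a := by
  rw [quad_mul_quad, quad_mul_quad, add_comm n a]
  have e1 : w.cubic (fun s r p => κ' s r * κ (n + s + r) p) (a + n)
      = w.cubic (fun s r p => κ s r * κ' p (a + s + r)) (a + n) := by
    simp only [h]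
    rw [cubic_rotate]
  have e2 : w.cubic (fun s r p => κ s r * κ' (a + s + r) p) (a + n)
      = w.cubic (fun s r p => κ' s r * κ p (n + s + r)) (a + n) := by
    simp only [h']
    rw [cubic_rotate]
  have e3 : w.dsum (fun r => w.dsum fun s => κ' s r • (w.X (n + s + r) * w.quad κ a))
      = w.dsum (fun r => w.dsum fun s => κ s r • (w.X (a + s + r) * w.quad κ' n)) := by
    simp only [quad, mul_dsum, mul_smul_comm, ← dsum_smul, smul_smul]
    have swap : ∀ B : ℤ × ℤ → ℤ × ℤ → ℤ × ℤ → ℤ × ℤ → Module.End ℂ V,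
        (w.dsum fun r => w.dsum fun s => w.dsum fun r' => w.dsum fun s' => B r s r' s')
        = w.dsum fun r' => w.dsum fun s' => w.dsum fun r => w.dsum fun s => B r s r' s' := by
      intro B
      have i1 : ∀ r, (w.dsum fun s => w.dsum fun r' => w.dsum fun s' => B r s r' s')
          = w.dsum fun r' => w.dsum fun s' => w.dsum fun s => B r s r' s' := fun r => by
        rw [w.dsum_dsum_comm]
        congr 1; funext r'
        rw [w.dsum_dsum_comm]
      simp only [i1]
      rw [w.dsum_dsum_comm]
      congr 1; funext r'
      rw [w.dsum_dsum_comm]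
    rw [swap]
    simp only [mul_comm, w.X_comm (n + _ + _)]
  rw [e1, e2, e3]
  abel

/-- The operator `q^{−n₁n₂} μ d (-n) − ∑ s r, q^{n₂r₁+s₂n₁+s₂r₁} X (n + s + r) ∘ d s ∘ d r`. -/
noncomputable def lower (q μ : ℂ) (n : ℤ × ℤ) : Module.End ℂ V :=
  (q ^ (-(n.1 * n.2)) * μ) • w.d (-n)
    - w.quad (fun s r => q ^ (n.2 * r.1 + s.2 * n.1 + s.2 * r.1)) n

lemma lower_mul_X {q : ℂ} (hq : q ≠ 0) (μ : ℂ) (n k : ℤ × ℤ) :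
    w.lower q μ n * w.X k = w.X k * w.lower q μ n
      + (if n + k = 0 then (q ^ (n.2 * k.1) * μ) • (1 : Module.End ℂ V) else 0)
      - q ^ (n.2 * k.1) • w.first (fun s => q ^ (s.2 * (n + k).1)) (n + k)
      - q ^ (k.2 * n.1) • w.first (fun s => q ^ (s.1 * (n + k).2)) (n + k) := by
  have e1 : w.first (fun s => q ^ (n.2 * k.1 + s.2 * n.1 + s.2 * k.1)) (n + k)
      = q ^ (n.2 * k.1) • w.first (fun s => q ^ (s.2 * (n + k).1)) (n + k) := by
    simp only [first, ← dsum_smul, smul_smul, ← zpow_add₀ hq]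
    congr! 4
    rw [Prod.fst_add]; ring
  have e2 : w.first (fun s => q ^ (n.2 * s.1 + k.2 * n.1 + k.2 * s.1)) (n + k)
      = q ^ (k.2 * n.1) • w.first (fun s => q ^ (s.1 * (n + k).2)) (n + k) := by
    simp only [first, ← dsum_smul, smul_smul, ← zpow_add₀ hq]
    congr! 4
    rw [Prod.snd_add]; ring
  rw [lower, sub_mul, quad_mul_X, smul_mul_assoc, d_mul_X, mul_sub, mul_smul_comm, e1, e2]
  by_cases h : n + k = 0
  · obtain rfl : k = -n := (neg_eq_of_add_eq_zero_right h).symm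
    have : -(n.1 * n.2) = n.2 * (-n).1 := by simp [mul_comm]
    rw [if_pos rfl, if_pos h, ← this, smul_add]
    abel
  · have h' : -n ≠ k := by rintro rfl; exact h (by abel)
    rw [if_neg h', if_neg h, add_zero, add_zero]
    abel

lemma lower_comm {q : ℂ} (hq : q ≠ 0) (μ : ℂ) (a n : ℤ × ℤ) :
    w.lower q μ a * w.lower q μ n = w.lower q μ n * w.lower q μ a := by
  have hQ := w.quad_comm (fun s r => q ^ (a.2 * r.1 + s.2 * a.1 + s.2 * r.1))
    (fun s r => q ^ (n.2 * r.1 + s.2 * n.1 + s.2 * r.1)) a n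
    (fun s r p => by
      simp only [← zpow_add₀ hq, Prod.fst_add, Prod.snd_add]
      congr 1; ring)
    (fun s r p => by
      simp only [← zpow_add₀ hq, Prod.fst_add, Prod.snd_add]
      congr 1; ring)
  have hd : q ^ (-(a.1 * a.2)) • w.dsum (fun r =>
        q ^ (n.2 * r.1 + (-a - n - r).2 * n.1 + (-a - n - r).2 * r.1) • w.d (-a - n - r))
      = q ^ (-(n.1 * n.2)) • w.dsum (fun r =>
        q ^ (a.2 * r.1 + (-n - a - r).2 * a.1 + (-n - a - r).2 * r.1) • w.d (-n - a - r)) := by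
    have key : ∀ (c : ℤ × ℤ → ℂ) (N : ℤ × ℤ), w.dsum (fun r => c r • w.d (N - r))
        = w.dsum fun r => c (N - r) • w.d (N - r) := by
      intro c N
      have : ∀ c : ℤ × ℤ → ℂ, w.dsum (fun r => c r • w.d (N - r))
          = w.dsum fun r => w.dsum fun s => if s = N - r then c r • 1 else 0 := by
        intro c
        simp only [dsum_ite, smul_mul_assoc, one_mul]
      rw [this, this, dsum_dsum_comm]
      congr 1; funext s
      congr 1; funext r
      by_cases h : s = N - r
      · subst h; simp
      · have h' : r ≠ N - s := by rintro rfl; exact h (by abel)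
        simp [h, h']
    rw [key _ (-n - a), ← dsum_smul, ← dsum_smul, show -a - n = -n - a by abel]
    simp only [smul_smul, ← zpow_add₀ hq]
    congr! 4
    simp
    ring
  simp only [lower, sub_mul, mul_sub, hQ, smul_mul_assoc, mul_smul_comm, d_mul_quad, w.d_comm (-a),
    smul_add]
  have hd' : (q ^ (-(a.1 * a.2)) * μ) • w.dsum (fun r =>
        q ^ (n.2 * r.1 + (-a - n - r).2 * n.1 + (-a - n - r).2 * r.1) • w.d (-a - n - r))
      = (q ^ (-(n.1 * n.2)) * μ) • w.dsum (fun r =>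
        q ^ (a.2 * r.1 + (-n - a - r).2 * a.1 + (-n - a - r).2 * r.1) • w.d (-n - a - r)) := by
    rw [mul_comm, mul_comm _ μ, mul_smul, mul_smul, hd]
  rw [hd']
  module

/-- Commutation of a first order operator with the lowering operators, under a cocycle condition on
its coefficients. -/
lemma first_mul_lower {q : ℂ} (μ : ℂ) (ψ : ℤ × ℤ → ℂ) (n a : ℤ × ℤ) (c : ℂ)
    (h₁ : q ^ (-(a.1 * a.2)) * ψ (-a - n) = c * q ^ (-((n + a).1 * (n + a).2)))
    (h₂ : ∀ s r : ℤ × ℤ, q ^ (a.2 * r.1 + s.2 * a.1 + s.2 * r.1) * ψ (a + s + r)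
        - ψ s * q ^ (a.2 * r.1 + (n + s).2 * a.1 + (n + s).2 * r.1)
        - ψ r * q ^ (a.2 * (n + r).1 + s.2 * a.1 + s.2 * (n + r).1)
      = -(c * q ^ ((n + a).2 * r.1 + s.2 * (n + a).1 + s.2 * r.1))) :
    w.first ψ n * w.lower q μ a = w.lower q μ a * w.first ψ n - c • w.lower q μ (n + a) := by
  have hQ : w.quad (fun s r => -(c * q ^ ((n + a).2 * r.1 + s.2 * (n + a).1 + s.2 * r.1))) (n + a)
      = -(c • w.quad (fun s r => q ^ ((n + a).2 * r.1 + s.2 * (n + a).1 + s.2 * r.1)) (n + a)) := by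
    rw [← neg_smul]
    simp only [← neg_mul, quad, ← dsum_smul, smul_smul]
  rw [lower, mul_sub, sub_mul, first_mul_quad, w.quad_congr _ h₂, mul_smul_comm, smul_mul_assoc,
    d_mul_first, hQ, smul_add, smul_smul, lower, smul_sub, smul_smul, ← mul_assoc c, ← h₁,
    show -(n + a) = -a - n by abel, mul_right_comm]
  abel

lemma first_apply (ψ : ℤ × ℤ → ℂ) (n : ℤ × ℤ) {v : V} {S : Finset (ℤ × ℤ)}
    (hS : ∀ s, s ∉ S → w.d s v = 0) :
    w.first ψ n v = ∑ s ∈ S, ψ s • w.X (n + s) (w.d s v) := by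
  rw [first, w.dsum_apply _ hS]
  rfl

lemma quad_apply (κ : ℤ × ℤ → ℤ × ℤ → ℂ) (n : ℤ × ℤ) {v : V} {S : Finset (ℤ × ℤ)}
    (hS : ∀ s, s ∉ S → w.d s v = 0) :
    w.quad κ n v = ∑ s ∈ S, ∑ r ∈ S, κ s r • w.X (n + s + r) (w.d s (w.d r v)) := by
  have h' : ∀ r s, s ∉ S → w.d s (w.d r v) = 0 := fun r s hs => by rw [d_d, hS s hs, map_zero]
  rw [quad, w.dsum_apply _ hS, Finset.sum_comm]
  simp only [w.dsum_apply _ (h' _)]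
  rfl

lemma lower_apply (q μ : ℂ) (n : ℤ × ℤ) (v : V) :
    w.lower q μ n v = (q ^ (-(n.1 * n.2)) * μ) • w.d (-n) v
      - w.quad (fun s r => q ^ (n.2 * r.1 + s.2 * n.1 + s.2 * r.1)) n v := rfl

/-- The vectors killed by all products of `D` of the derivations `d s`, `s ∈ A`. -/
noncomputable def fil (A : Set (ℤ × ℤ)) : ℕ → Submodule ℂ V
  | 0 => ⊥
  | D + 1 => ⨅ s ∈ A, (fil A D).comap (w.d s)

variable {A : Set (ℤ × ℤ)}

lemma mem_fil_zero {v : V} : v ∈ w.fil A 0 ↔ v = 0 := Iff.rfl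

lemma mem_fil_succ {D : ℕ} {v : V} : v ∈ w.fil A (D + 1) ↔ ∀ s ∈ A, w.d s v ∈ w.fil A D := by
  simp [fil]

lemma fil_le_succ (D : ℕ) : w.fil A D ≤ w.fil A (D + 1) := by
  induction D with
  | zero => exact bot_le
  | succ D ih =>
    intro v hv
    rw [mem_fil_succ] at hv ⊢
    exact fun s hs => ih (hv s hs)

lemma fil_mono : Monotone (w.fil A) := monotone_nat_of_le_succ w.fil_le_succ

lemma d_mem_fil (s : ℤ × ℤ) {D : ℕ} {v : V} (hv : v ∈ w.fil A D) : w.d s v ∈ w.fil A D := by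
  induction D generalizing v with
  | zero => simp_all [mem_fil_zero]
  | succ D ih =>
    rw [mem_fil_succ] at hv ⊢
    intro r hr
    rw [d_d]
    exact ih (hv r hr)

lemma X_mem_fil (k : ℤ × ℤ) {D : ℕ} {v : V} (hv : v ∈ w.fil A D) :
    w.X k v ∈ w.fil A (D + 1) := by
  induction D generalizing v with
  | zero => simp_all [mem_fil_zero]
  | succ D ih =>
    rw [mem_fil_succ]
    intro r hr
    rw [d_X]
    refine add_mem (ih (w.mem_fil_succ.mp hv r hr)) ?_
    split_ifs
    exacts [hv, zero_mem _]

lemma X_mem_fil_of_notMem {k : ℤ × ℤ} (hk : k ∉ A) {D : ℕ} {v : V} (hv : v ∈ w.fil A D) :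
    w.X k v ∈ w.fil A D := by
  induction D generalizing v with
  | zero => simp_all [mem_fil_zero]
  | succ D ih =>
    rw [mem_fil_succ] at hv ⊢
    intro r hr
    rw [d_X, if_neg (by rintro rfl; exact hk hr), add_zero]
    exact ih (hv r hr)

lemma X_d_mem_fil {s : ℤ × ℤ} (hs : s ∈ A) (k : ℤ × ℤ) {D : ℕ} {v : V} (hv : v ∈ w.fil A D) :
    w.X k (w.d s v) ∈ w.fil A D := by
  cases D with
  | zero => simp_all [mem_fil_zero]
  | succ D => exact w.X_mem_fil k (w.mem_fil_succ.mp hv s hs)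

lemma lower_mem_fil (q μ : ℂ) (n : ℤ × ℤ) {D : ℕ} {v : V} (hv : v ∈ w.fil Set.univ (D + 1)) :
    w.lower q μ n v ∈ w.fil Set.univ D := by
  obtain ⟨S, hS⟩ := w.exists_finset v
  rw [mem_fil_succ] at hv
  rw [lower_apply, w.quad_apply _ _ hS]
  exact sub_mem (Submodule.smul_mem _ _ (hv _ (Set.mem_univ _))) <| sum_mem fun s _ =>
    sum_mem fun r _ => Submodule.smul_mem _ _ (w.X_d_mem_fil (Set.mem_univ s) _ (hv r (Set.mem_univ r)))

/-- A combination of exponential sequences vanishing at all large integers vanishes identically. -/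
lemma sum_zpow_smul_eq_zero {ι : Type*} (I : Finset ι) (c : ι → ℂ) (hc : ∀ i, c i ≠ 0) (v : ι → V)
    (J : ℤ) (h : ∀ j ≥ J, ∑ i ∈ I, c i ^ j • v i = 0) (j : ℤ) : ∑ i ∈ I, c i ^ j • v i = 0 := by
  classical
  induction I using Finset.induction_on generalizing v j with
  | empty => simp
  | insert i I hi ih =>
    have step : ∀ j : ℤ, ∑ k ∈ insert i I, c k ^ (j + 1) • v k
        = c i • ∑ k ∈ insert i I, c k ^ j • v k
          + ∑ k ∈ I, c k ^ j • ((c k - c i) • v k) := by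
      intro j
      rw [Finset.sum_insert hi, Finset.sum_insert hi, smul_add, Finset.smul_sum, add_assoc,
        ← Finset.sum_add_distrib]
      congr 1
      · rw [zpow_add_one₀ (hc i), smul_smul, mul_comm]
      · refine Finset.sum_congr rfl fun k _ => ?_
        rw [zpow_add_one₀ (hc k)]
        module
    have h0 : ∀ j : ℤ, ∑ k ∈ I, c k ^ j • ((c k - c i) • v k) = 0 := by
      refine ih _ fun j hj => ?_
      have := step j
      rw [h j hj, h (j + 1) (by omega)] at this
      simpa using this.symm
    have back : ∀ t : ℕ, ∑ k ∈ insert i I, c k ^ (J - t) • v k = 0 := by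
      intro t
      induction t with
      | zero => exact h _ (by simp)
      | succ t iht =>
        have := step (J - (t + 1 : ℕ))
        rw [h0, add_zero, show J - (t + 1 : ℕ) + 1 = J - t by push_cast; ring, iht] at this
        exact (smul_eq_zero.mp this.symm).resolve_left (hc i)
    rcases le_total J j with hj | hj
    · exact h j hj
    · have := back (J - j).toNat
      rwa [Int.toNat_of_nonneg (by omega), sub_sub_cancel] at this

lemma d_eq_zero_of_lower_eq_zero {q μ : ℂ} (hq : q ≠ 0) (hμ : μ ≠ 0) {v : V}
    (h : ∀ n, w.lower q μ n v = 0) (s : ℤ × ℤ) : w.d s v = 0 := by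
  classical
  obtain ⟨S, hS⟩ := w.exists_finset v
  let F : ℤ × ℤ → ℤ × ℤ → V := fun t n => ∑ p ∈ (S ×ˢ S) with p.1 + p.2 = t,
    q ^ (n.2 * p.2.1 + p.1.2 * n.1 + p.1.2 * p.2.1) • w.d p.1 (w.d p.2 v)
  have hgen : ∀ t n, n + t ∉ S → F t n = 0 := by
    intro t n hn
    have h1 := congrArg (w.d (n + t)) (h n)
    rw [lower_apply, w.quad_apply _ _ hS, map_sub, map_smul, d_d, hS _ hn, map_zero, smul_zero,
      zero_sub, map_zero, neg_eq_zero] at h1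
    rw [← h1, ← Finset.sum_product']
    simp only [F, Finset.sum_filter, map_sum, map_smul, d_X]
    refine Finset.sum_congr rfl fun p _ => ?_
    have hz : w.d (n + t) (w.d p.1 (w.d p.2 v)) = 0 := by
      rw [w.d_d (n + t) p.1, w.d_d (n + t) p.2, hS _ hn, map_zero, map_zero]
    rw [hz, map_zero, zero_add]
    by_cases hp : p.1 + p.2 = t
    · rw [if_pos hp, if_pos (by rw [add_assoc, hp])]
    · rw [if_neg hp, if_neg (fun h => hp (by rw [add_assoc] at h; exact (add_left_cancel h).symm)),
        smul_zero]
  have hF : ∀ t n, F t n = 0 := by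
    intro t n
    obtain ⟨J, hJ⟩ : ∃ J : ℤ, ∀ p ∈ S, p.1 < J := by
      obtain ⟨J, hJ⟩ := (S.image Prod.fst).bddAbove
      refine ⟨J + 1, fun p hp => Int.lt_add_one_of_le (hJ ?_)⟩
      simpa using ⟨p.2, hp⟩
    have := sum_zpow_smul_eq_zero ((S ×ˢ S).filter fun p => p.1 + p.2 = t)
      (fun p => q ^ p.1.2) (fun p => zpow_ne_zero _ hq)
      (fun p => q ^ (n.2 * p.2.1 + p.1.2 * p.2.1) • w.d p.1 (w.d p.2 v)) (J - t.1)
    have e : ∀ j : ℤ, ∑ p ∈ (S ×ˢ S) with p.1 + p.2 = t, (q ^ p.1.2) ^ j •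
        q ^ (n.2 * p.2.1 + p.1.2 * p.2.1) • w.d p.1 (w.d p.2 v) = F t (j, n.2) := by
      intro j
      refine Finset.sum_congr rfl fun p _ => ?_
      rw [smul_smul, ← zpow_mul, ← zpow_add₀ hq]
      congr 2; ring
    simp only [e] at this
    refine this (fun j hj => hgen _ _ fun hmem => ?_) n.1
    have := hJ _ hmem
    simp only [Prod.fst_add] at this
    omega
  have hQ : ∀ n, w.quad (fun s r => q ^ (n.2 * r.1 + s.2 * n.1 + s.2 * r.1)) n v = 0 := by
    intro n
    rw [w.quad_apply _ _ hS, ← Finset.sum_product',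
      ← Finset.sum_fiberwise_of_maps_to (s := S ×ˢ S) (t := (S ×ˢ S).image fun p => p.1 + p.2)
        (g := fun p => p.1 + p.2) fun p hp => Finset.mem_image_of_mem _ hp]
    refine Finset.sum_eq_zero fun t _ => ?_
    rw [← map_zero (w.X (n + t)), ← hF t n, map_sum]
    refine Finset.sum_congr rfl fun p hp => ?_
    rw [map_smul, ← (Finset.mem_filter.mp hp).2, add_assoc n]
  have := h (-s)
  rw [lower_apply, hQ, sub_zero, neg_neg] at this
  exact (smul_eq_zero.mp this).resolve_left (mul_ne_zero (zpow_ne_zero _ hq) hμ)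

/-- The Euler operator. -/
noncomputable def euler : Module.End ℂ V := w.first (fun _ => 1) 0

lemma euler_mul_X (k : ℤ × ℤ) : w.euler * w.X k = w.X k * w.euler + w.X k := by
  rw [euler, first_mul_X, one_smul, zero_add]

lemma euler_mul_lower (q μ : ℂ) (a : ℤ × ℤ) :
    w.euler * w.lower q μ a = w.lower q μ a * w.euler - w.lower q μ a := by
  rw [euler, w.first_mul_lower μ (fun _ => 1) 0 a 1 (by simp) (by intro s r; simp), zero_add,
    one_smul]

lemma partial_euler_sub_mem_fil {m : ℤ × ℤ} {S : Finset (ℤ × ℤ)} (hm : m ∉ S) (D : ℕ) {f : V}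
    (hS : ∀ s, s ≠ m → s ∉ S → w.d s f = 0) (hf : f ∈ w.fil {m}ᶜ (D + 1)) :
    ∑ s ∈ S, w.X s (w.d s f) - (D : ℂ) • f ∈ w.fil {m}ᶜ D := by
  induction D generalizing f with
  | zero =>
    rw [mem_fil_succ] at hf
    rw [Finset.sum_eq_zero]
    · simp
    · intro s hs
      rw [w.mem_fil_zero.mp (hf s (by rintro rfl; exact hm hs)), map_zero]
  | succ D ih =>
    rw [mem_fil_succ] at hf ⊢
    intro r hr
    have hr' : r ≠ m := by simpa using hr
    have := ih (f := w.d r f) (fun s hs hs' => by rw [d_d, hS s hs hs', map_zero]) (hf r hr)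
    convert this using 1
    have e : w.d r (∑ s ∈ S, w.X s (w.d s f)) = ∑ s ∈ S, w.X s (w.d s (w.d r f)) + w.d r f := by
      simp only [map_sum, d_X, Finset.sum_add_distrib, Finset.sum_ite_eq, w.d_d r]
      congr 1
      split_ifs with h
      · rfl
      · exact (hS r hr' h).symm
    rw [map_sub, map_smul, e]
    push_cast
    module

lemma X_lower_sub_mem_fil (q μ : ℂ) (m : ℤ × ℤ) (D : ℕ) (α : ℂ) {f : V}
    (hf : f ∈ w.fil {m}ᶜ (D + 1)) (hα : w.euler f = α • f) :
    w.X m (w.lower q μ (-m) f) - (q ^ (-(m.1 * m.2)) * ((α - D) * (μ - α - D + 1))) • f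
      ∈ w.fil {m}ᶜ D := by
  classical
  obtain ⟨S', hS'⟩ := w.exists_finset f
  obtain ⟨S, hmS, hS⟩ : ∃ S : Finset (ℤ × ℤ), m ∉ S ∧ ∀ s, s ∉ insert m S → w.d s f = 0 :=
    ⟨S'.erase m, by simp, fun s hs => hS' s fun h => hs (by
      by_cases h' : s = m <;> simp [h, h'])⟩
  have hne : ∀ s ∈ S, s ≠ m := fun s hs h => hmS (h ▸ hs)
  set P : Module.End ℂ V := ∑ s ∈ S, w.X s * w.d s with hP
  have P_apply : ∀ v, P v = ∑ s ∈ S, w.X s (w.d s v) := fun v => by simp [hP]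
  have P_mem : ∀ v ∈ w.fil {m}ᶜ D, P v ∈ w.fil {m}ᶜ D := fun v hv => by
    rw [P_apply]
    exact sum_mem fun s hs => w.X_d_mem_fil (hne s hs) s hv
  obtain ⟨ρ, hρ⟩ : ∃ ρ, P f - (D : ℂ) • f = ρ := ⟨_, rfl⟩
  have ρ_mem : ρ ∈ w.fil {m}ᶜ D := by
    rw [← hρ, P_apply]
    exact w.partial_euler_sub_mem_fil hmS D (fun s h h' => hS s (by simp [h, h'])) hf
  have hE : w.X m (w.d m f) + P f = α • f := by
    rw [← hα, euler, w.first_apply _ _ hS, Finset.sum_insert hmS, P_apply]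
    simp
  have PX : ∀ v, P (w.X m v) = w.X m (P v) := fun v => by
    rw [P_apply, P_apply, map_sum]
    refine Finset.sum_congr rfl fun s hs => ?_
    rw [d_X, if_neg (hne s hs), add_zero, X_X]
  obtain ⟨R, hR⟩ : ∃ R, ∑ s ∈ S, ∑ r ∈ S, q ^ ((-m).2 * r.1 + s.2 * (-m).1 + s.2 * r.1) •
      w.X (-m + s + r) (w.d s (w.d r f)) = R := ⟨_, rfl⟩
  have R_mem : R ∈ w.fil {m}ᶜ D := by
    rw [← hR]
    exact sum_mem fun s hs => sum_mem fun r hr => Submodule.smul_mem _ _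
      (w.X_d_mem_fil (hne s hs) _ (w.mem_fil_succ.mp hf r (hne r hr)))
  set q₀ := q ^ (-(m.1 * m.2)) with hq₀
  have hquad : w.quad (fun s r => q ^ ((-m).2 * r.1 + s.2 * (-m).1 + s.2 * r.1)) (-m) f
      = q₀ • (w.X m (w.d m (w.d m f)) + (2 : ℂ) • P (w.d m f)) + R := by
    rw [w.quad_apply _ _ hS, Finset.sum_insert hmS, Finset.sum_insert hmS]
    simp only [Finset.sum_insert hmS, Finset.sum_add_distrib]
    rw [hR, P_apply, smul_add, smul_comm q₀ (2 : ℂ), two_smul, Finset.smul_sum]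
    have e1 : ∀ r : ℤ × ℤ, (-m).2 * r.1 + m.2 * (-m).1 + m.2 * r.1 = -(m.1 * m.2) := fun r => by
      rw [Prod.fst_neg, Prod.snd_neg]; ring
    have e2 : ∀ s : ℤ × ℤ, (-m).2 * m.1 + s.2 * (-m).1 + s.2 * m.1 = -(m.1 * m.2) := fun r => by
      rw [Prod.fst_neg, Prod.snd_neg]; ring
    simp only [e1, e2, neg_add_cancel, zero_add, neg_add_cancel_comm, w.d_d _ m f, ← hq₀]
    simp only [w.d_d m]
    abel
  have hT : w.lower q μ (-m) f = (q₀ * μ) • w.d m f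
      - (q₀ • (w.X m (w.d m (w.d m f)) + (2 : ℂ) • P (w.d m f)) + R) := by
    rw [lower_apply, hquad, neg_neg, Prod.fst_neg, Prod.snd_neg, neg_mul_neg]
  have hXh : w.X m (w.d m f) = (α - D) • f - ρ := by
    rw [← hρ]; linear_combination (norm := module) hE
  have h1 : w.X m (w.X m (w.d m (w.d m f)))
      = (α - D - 1) • ((α - D) • f - ρ) - w.X m (w.d m ρ) := by
    have := w.d_X m m (w.d m f)
    rw [if_pos rfl, hXh, map_sub, map_smul] at this
    have := congrArg (w.X m) this
    rw [map_sub, map_smul, map_add, hXh] at this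
    linear_combination (norm := module) (-1 : ℂ) • this
  have h2 : w.X m (P (w.d m f)) = (α - D) • ((D : ℂ) • f + ρ) - P ρ := by
    rw [← PX, hXh, map_sub, map_smul, ← hρ]
    module
  have key : w.X m (w.lower q μ (-m) f) - (q₀ * ((α - D) * (μ - α - D + 1))) • f
      = q₀ • ((α - D - 1 - μ - 2 * (α - D)) • ρ + w.X m (w.d m ρ) + (2 : ℂ) • P ρ) - w.X m R := by
    rw [hT, map_sub, map_add, map_smul, map_smul, map_add, map_smul, h1, h2, hXh]
    module
  rw [key]
  have hmA : m ∉ ({m}ᶜ : Set (ℤ × ℤ)) := by simp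
  refine sub_mem (Submodule.smul_mem _ _ (add_mem (add_mem (Submodule.smul_mem _ _ ρ_mem) ?_)
    (Submodule.smul_mem _ _ (P_mem _ ρ_mem)))) (w.X_mem_fil_of_notMem hmA R_mem)
  exact w.X_mem_fil_of_notMem hmA (w.d_mem_fil m ρ_mem)

end WeylFamily

namespace WeylFamily

/-- The Weyl family obtained by adding `Y` to the derivation `d m`. -/
noncomputable def twist {V : Type*} [AddCommGroup V] [Module ℂ V] (w : WeylFamily V) (m : ℤ × ℤ)
    (Y : Module.End ℂ V) (hX : ∀ k, Y * w.X k = w.X k * Y)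
    (hd : ∀ s, s ≠ m → Y * w.d s = w.d s * Y) : WeylFamily V where
  X := w.X
  d s := w.d s + if s = m then Y else 0
  X_comm := w.X_comm
  d_comm s r := by
    by_cases hs : s = m <;> by_cases hr : r = m
    · rw [hs, hr]
    · rw [if_pos hs, if_neg hr, add_zero, add_mul, mul_add, hd r hr, w.d_comm s]
    · rw [if_neg hs, if_pos hr, add_zero, add_mul, mul_add, hd s hs, w.d_comm s]
    · rw [if_neg hs, if_neg hr, add_zero, add_zero, w.d_comm s]
  d_mul_X s k := by
    rw [add_mul, mul_add, w.d_mul_X]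
    split_ifs <;> simp only [hX, zero_mul, mul_zero] <;> abel
  finite v := by
    classical
    refine ((w.finite v).union (Set.finite_singleton m)).subset fun s hs => ?_
    by_contra h
    simp only [Set.mem_union, Function.mem_support, ne_eq, Set.mem_singleton_iff, not_or,
      not_not] at h
    exact hs (by simp [h.1, h.2])

end WeylFamily

section Concrete

variable {m : ℤ × ℤ}

lemma XmZ_apply (j : ℤ) (g : NN m) (k : ℤ) : XmZ m j g k = g (k - j) := by
  have := Finsupp.mapDomain_apply (add_left_injective j) g (k - j)
  rwa [sub_add_cancel] at this

lemma Xop_self_apply (g : NN m) (k : ℤ) : Xop m m g k = g (k - 1) := by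
  rw [Xop, dif_pos rfl, XmZ_apply]

lemma Xop_apply {s : ℤ × ℤ} (h : s ≠ m) (g : NN m) (k : ℤ) :
    Xop m s g k = X (⟨s, h⟩ : NVar m) * g k := by
  rw [Xop, dif_neg h, Finsupp.mapRange_apply]

lemma Dop_self_apply (g : NN m) (k : ℤ) : Dop m m g k = (k + 1) • g (k + 1) := by
  rw [Dop, dif_pos rfl, Finsupp.sum_apply, Finsupp.sum_eq_single (k + 1)]
  · simp
  · intro l _ hl
    rw [Finsupp.single_apply, if_neg (by omega)]
  · simp

lemma Dop_apply {s : ℤ × ℤ} (h : s ≠ m) (g : NN m) (k : ℤ) :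
    Dop m s g k = pderiv (⟨s, h⟩ : NVar m) (g k) := by
  rw [Dop, dif_neg h, Finsupp.mapRange_apply]

lemma Dop_eq_zero_of_notMem_nvars {g : NN m} {s : ℤ × ℤ} (hs : s ∉ nvars m g) :
    Dop m s g = 0 := by
  rw [nvars, Finset.mem_insert, not_or, Finset.mem_biUnion] at hs
  ext1 k
  rw [Dop_apply hs.1, Finsupp.zero_apply]
  by_cases hk : g k = 0
  · rw [hk, map_zero]
  · refine pderiv_eq_zero_of_notMem_vars fun h => hs.2 ⟨k, by simpa using hk, ?_⟩
    exact Finset.mem_image.mpr ⟨_, h, rfl⟩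

/-- Multiplication by an integer power of `x_m` as a linear map. -/
noncomputable def XmZLin (m : ℤ × ℤ) (j : ℤ) : Module.End ℂ (NN m) where
  toFun := XmZ m j
  map_add' f g := by ext1 k; simp only [XmZ_apply, Finsupp.add_apply]
  map_smul' c g := by ext1 k; simp only [XmZ_apply, Finsupp.smul_apply, RingHom.id_apply]

/-- Multiplication by a variable as a linear map. -/
noncomputable def XopLin (m s : ℤ × ℤ) : Module.End ℂ (NN m) where
  toFun := Xop m s
  map_add' f g := by
    ext1 k
    by_cases h : s = m
    · subst h; simp only [Xop_self_apply, Finsupp.add_apply]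
    · simp only [Xop_apply h, Finsupp.add_apply, mul_add]
  map_smul' c g := by
    ext1 k
    by_cases h : s = m
    · subst h; simp only [Xop_self_apply, Finsupp.smul_apply, RingHom.id_apply]
    · simp only [Xop_apply h, Finsupp.smul_apply, RingHom.id_apply, mul_smul_comm]

/-- Partial differentiation as a linear map. -/
noncomputable def DopLin (m s : ℤ × ℤ) : Module.End ℂ (NN m) where
  toFun := Dop m s
  map_add' f g := by
    ext1 k
    by_cases h : s = m
    · subst h; simp only [Dop_self_apply, Finsupp.add_apply, smul_add]
    · simp only [Dop_apply h, Finsupp.add_apply, map_add]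
  map_smul' c g := by
    ext1 k
    by_cases h : s = m
    · subst h
      simp only [Dop_self_apply, Finsupp.smul_apply, RingHom.id_apply]
      rw [smul_comm]
    · simp only [Dop_apply h, Finsupp.smul_apply, RingHom.id_apply, Derivation.map_smul]

lemma XopLin_apply (s : ℤ × ℤ) (g : NN m) : XopLin m s g = Xop m s g := rfl

lemma DopLin_apply (s : ℤ × ℤ) (g : NN m) : DopLin m s g = Dop m s g := rfl

lemma XmZLin_apply (j : ℤ) (g : NN m) : XmZLin m j g = XmZ m j g := rfl

lemma XopLin_comm (s r : ℤ × ℤ) : XopLin m s * XopLin m r = XopLin m r * XopLin m s := by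
  refine LinearMap.ext fun g => Finsupp.ext fun k => ?_
  simp only [Module.End.mul_apply, XopLin_apply]
  by_cases hs : s = m <;> by_cases hr : r = m <;> (try subst hs) <;> (try subst hr) <;>
    simp only [Xop_self_apply, Xop_apply, *, ne_eq, not_false_eq_true]
  ring

lemma pderiv_pderiv_comm {σ R : Type*} [CommRing R] (i j : σ) (p : MvPolynomial σ R) :
    pderiv i (pderiv j p) = pderiv j (pderiv i p) := by
  classical
  let E : Derivation R (MvPolynomial σ R) (MvPolynomial σ R) := ⁅pderiv (R := R) i, pderiv (R := R) j⁆
  have hE : E = 0 := by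
    refine MvPolynomial.derivation_ext fun k => ?_
    rw [Derivation.commutator_apply, pderiv_X, pderiv_X]
    simp [Pi.single_apply, apply_ite]
  have h : E p = 0 := by rw [hE]; rfl
  rw [Derivation.commutator_apply] at h
  exact sub_eq_zero.mp h

lemma DopLin_comm (s r : ℤ × ℤ) : DopLin m s * DopLin m r = DopLin m r * DopLin m s := by
  refine LinearMap.ext fun g => Finsupp.ext fun k => ?_
  simp only [Module.End.mul_apply, DopLin_apply]
  by_cases hs : s = m <;> by_cases hr : r = m <;> (try subst hs) <;> (try subst hr) <;>
    simp only [Dop_self_apply, Dop_apply, *, ne_eq, not_false_eq_true, map_zsmul]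
  exact pderiv_pderiv_comm _ _ _

lemma DopLin_mul_XopLin (s k : ℤ × ℤ) :
    DopLin m s * XopLin m k = XopLin m k * DopLin m s + if s = k then 1 else 0 := by
  refine LinearMap.ext fun g => Finsupp.ext fun i => ?_
  have e : ((if s = k then 1 else 0 : Module.End ℂ (NN m)) g) i = if s = k then g i else 0 := by
    split_ifs <;> rfl
  simp only [Module.End.mul_apply, DopLin_apply, XopLin_apply, LinearMap.add_apply,
    Finsupp.add_apply, e]
  by_cases hs : s = m
  · subst hs
    by_cases hk : k = s
    · subst hk
      rw [Dop_self_apply, Xop_self_apply, Xop_self_apply, Dop_self_apply, if_pos rfl,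
        add_sub_cancel_right, sub_add_cancel, add_smul, one_smul]
    · rw [Dop_self_apply, Xop_apply hk, Xop_apply hk, Dop_self_apply, if_neg (Ne.symm hk),
        add_zero, mul_smul_comm]
  · by_cases hk : k = m
    · subst hk
      rw [Dop_apply hs, Xop_self_apply, Xop_self_apply, Dop_apply hs, if_neg hs, add_zero]
    · classical
      rw [Dop_apply hs, Xop_apply hk, Xop_apply hk, Dop_apply hs, Derivation.leibniz, pderiv_X,
        smul_eq_mul, smul_eq_mul]
      by_cases h : s = k
      · subst h
        simp
      · rw [if_neg h, Pi.single_eq_of_ne (by simpa using Ne.symm h)]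
        simp

lemma XmZLin_mul_XopLin (j : ℤ) (k : ℤ × ℤ) :
    XmZLin m j * XopLin m k = XopLin m k * XmZLin m j := by
  refine LinearMap.ext fun g => Finsupp.ext fun i => ?_
  simp only [Module.End.mul_apply, XmZLin_apply, XopLin_apply]
  by_cases hk : k = m
  · subst hk
    simp only [XmZ_apply, Xop_self_apply]
    congr 1; ring
  · simp only [XmZ_apply, Xop_apply hk]

lemma XmZLin_mul_DopLin (j : ℤ) {s : ℤ × ℤ} (hs : s ≠ m) :
    XmZLin m j * DopLin m s = DopLin m s * XmZLin m j := by
  refine LinearMap.ext fun g => Finsupp.ext fun i => ?_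
  simp only [Module.End.mul_apply, XmZLin_apply, DopLin_apply, XmZ_apply, Dop_apply hs]

lemma DopLin_self_mul_XmZLin (j : ℤ) :
    DopLin m m * XmZLin m j = XmZLin m j * DopLin m m + (j : ℂ) • XmZLin m (j - 1) := by
  refine LinearMap.ext fun g => Finsupp.ext fun i => ?_
  simp only [Module.End.mul_apply, XmZLin_apply, DopLin_apply, XmZ_apply, Dop_self_apply,
    LinearMap.add_apply, LinearMap.smul_apply, Finsupp.add_apply, Finsupp.smul_apply]
  rw [show i + 1 - j = i - j + 1 by ring, show i - (j - 1) = i - j + 1 by ring, Int.cast_smul_eq_zsmul,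
    ← add_smul]
  congr 1; ring

lemma XmZLin_mul_XmZLin (j l : ℤ) : XmZLin m j * XmZLin m l = XmZLin m (j + l) := by
  refine LinearMap.ext fun g => Finsupp.ext fun i => ?_
  simp only [Module.End.mul_apply, XmZLin_apply, XmZ_apply]
  congr 1; ring

/-- The multiplication operators and the partial derivatives on `N`. -/
noncomputable def weyl (m : ℤ × ℤ) : WeylFamily (NN m) where
  X := XopLin m
  d := DopLin m
  X_comm := XopLin_comm
  d_comm := DopLin_comm
  d_mul_X := DopLin_mul_XopLin
  finite g := by
    refine (nvars m g).finite_toSet.subset fun s hs => ?_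
    by_contra h
    exact hs (Dop_eq_zero_of_notMem_nvars h)

/-- The multiplication operators together with the derivations twisted by `x_m ^ (-b)`. -/
noncomputable def twistedWeyl (m : ℤ × ℤ) (b : ℂ) : WeylFamily (NN m) :=
  (weyl m).twist m ((-b) • XmZLin m (-1))
    (fun k => by rw [smul_mul_assoc, mul_smul_comm]; exact congrArg _ (XmZLin_mul_XopLin _ _))
    (fun s hs => by rw [smul_mul_assoc, mul_smul_comm]; exact congrArg _ (XmZLin_mul_DopLin _ hs))

lemma twistedWeyl_X_apply (b : ℂ) (k : ℤ × ℤ) (g : NN m) :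
    (twistedWeyl m b).X k g = Xop m k g := rfl

lemma twistedWeyl_d_self (b : ℂ) (g : NN m) :
    (twistedWeyl m b).d m g = Dop m m g - b • XmZ m (-1) g := by
  change Dop m m g + (if m = m then (-b) • XmZLin m (-1) else 0) g = _
  rw [if_pos rfl, LinearMap.smul_apply, XmZLin_apply, neg_smul, sub_eq_add_neg]

lemma twistedWeyl_d_of_ne (b : ℂ) {s : ℤ × ℤ} (hs : s ≠ m) (g : NN m) :
    (twistedWeyl m b).d s g = Dop m s g := by
  change Dop m s g + (if s = m then (-b) • XmZLin m (-1) else 0) g = _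
  rw [if_neg hs, LinearMap.zero_apply, add_zero]

end Concrete

namespace WeylFamily

section Twist

variable {V : Type*} [AddCommGroup V] [Module ℂ V] (w : WeylFamily V) (m : ℤ × ℤ)
  (Y : Module.End ℂ V) (hX : ∀ k, Y * w.X k = w.X k * Y)
  (hd : ∀ s, s ≠ m → Y * w.d s = w.d s * Y)

lemma twist_X : (w.twist m Y hX hd).X = w.X := rfl

lemma twist_d_apply (s : ℤ × ℤ) (v : V) :
    (w.twist m Y hX hd).d s v = w.d s v + if s = m then Y v else 0 := by
  change w.d s v + (if s = m then Y else 0) v = _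
  split_ifs <;> rfl

lemma twist_first_apply (ψ : ℤ × ℤ → ℂ) (n : ℤ × ℤ) (v : V) :
    (w.twist m Y hX hd).first ψ n v = w.first ψ n v + ψ m • w.X (m + n) (Y v) := by
  classical
  obtain ⟨S', hS'⟩ := w.exists_finset v
  obtain ⟨S, hm, hS⟩ : ∃ S : Finset (ℤ × ℤ), m ∈ S ∧ ∀ s, s ∉ S → w.d s v = 0 :=
    ⟨insert m S', by simp, fun s hs => hS' s fun h => hs (by simp [h])⟩
  rw [w.first_apply _ _ hS, first_apply (S := S)]
  · simp only [twist_d_apply, twist_X, map_add, smul_add, Finset.sum_add_distrib, apply_ite (w.X _),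
      map_zero, smul_ite, smul_zero, Finset.sum_ite_eq', if_pos hm, add_comm n m]
  · intro s hs
    rw [twist_d_apply, hS s hs, if_neg (by rintro rfl; exact hs hm), add_zero]

lemma twist_quad_apply (κ : ℤ × ℤ → ℤ × ℤ → ℂ) (n : ℤ × ℤ) {Z : Module.End ℂ V}
    (hZ : w.d m * Y = Y * w.d m + Z) (v : V) :
    (w.twist m Y hX hd).quad κ n v = w.quad κ n v + w.first (fun s => κ s m) (m + n) (Y v)
      + w.first (κ m) (m + n) (Y v) + κ m m • w.X (m + m + n) (Y (Y v) - Z v) := by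
  classical
  obtain ⟨S', hS₁, hS₂⟩ := w.exists_finset₂ v (Y v)
  obtain ⟨S, hm, hS, hSY⟩ : ∃ S : Finset (ℤ × ℤ), m ∈ S ∧ (∀ s, s ∉ S → w.d s v = 0) ∧
      ∀ s, s ∉ S → w.d s (Y v) = 0 :=
    ⟨insert m S', by simp, fun s hs => hS₁ s fun h => hs (by simp [h]),
      fun s hs => hS₂ s fun h => hs (by simp [h])⟩
  have hYd : ∀ r, Y (w.d r v) = w.d r (Y v) - if r = m then Z v else 0 := by
    intro r
    split_ifs with h
    · have := LinearMap.congr_fun hZ v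
      rw [h]
      exact eq_sub_of_add_eq this.symm
    · rw [sub_zero]
      exact LinearMap.congr_fun (hd r h) v
  rw [w.quad_apply _ _ hS, w.first_apply _ _ hSY, w.first_apply _ _ hSY, quad_apply (S := S)]
  · simp only [twist_d_apply, twist_X, map_add, smul_add, Finset.sum_add_distrib, hYd,
      apply_ite (w.X _), apply_ite (w.d _), apply_ite Y, map_sub, smul_sub, Finset.sum_sub_distrib,
      map_zero, smul_ite, smul_zero, Finset.sum_ite_eq', if_pos hm, Finset.sum_ite_irrel,
      Finset.sum_const_zero]
    have e1 : ∀ s, n + s + m = m + n + s := fun s => by abel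
    have e2 : ∀ s, n + m + s = m + n + s := fun s => by abel
    have e3 : m + m + n = m + n + m := by abel
    simp only [e1, e2, e3]
    abel
  · intro s hs
    rw [twist_d_apply, hS s hs, if_neg (by rintro rfl; exact hs hm), add_zero]

end Twist

end WeylFamily

section Identify

variable {m : ℤ × ℤ}

lemma weyl_d_eq_zero {g : NN m} {s : ℤ × ℤ} (hs : s ∉ nvars m g) : (weyl m).d s g = 0 :=
  Dop_eq_zero_of_notMem_nvars hs

lemma E22N_eq (q : ℂ) (n : ℤ × ℤ) (g : NN m) :
    E22N q m n g = (weyl m).first (fun s => q ^ (s.1 * n.2)) n g := by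
  rw [(weyl m).first_apply _ _ fun s => weyl_d_eq_zero]
  rfl

lemma E11N_eq (q μ : ℂ) (n : ℤ × ℤ) (g : NN m) :
    E11N q μ m n g = (if n = 0 then μ • g else 0)
      - (weyl m).first (fun s => q ^ (s.2 * n.1)) n g := by
  rw [(weyl m).first_apply _ _ fun s => weyl_d_eq_zero]
  rfl

lemma E12N_eq (q μ : ℂ) (n : ℤ × ℤ) (g : NN m) :
    E12N q μ m n g = (weyl m).lower q μ n g := by
  rw [WeylFamily.lower_apply, (weyl m).quad_apply _ _ fun s => weyl_d_eq_zero, mul_smul]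
  rfl

lemma D1N_eq (g : NN m) : D1N m g = (weyl m).first (fun s => (s.1 : ℂ)) 0 g := by
  rw [(weyl m).first_apply _ _ fun s => weyl_d_eq_zero]
  simp only [zero_add]
  rfl

lemma D2N_eq (g : NN m) : D2N m g = (weyl m).first (fun s => (s.2 : ℂ)) 0 g := by
  rw [(weyl m).first_apply _ _ fun s => weyl_d_eq_zero]
  simp only [zero_add]
  rfl

lemma twistedWeyl_first_apply (b : ℂ) (ψ : ℤ × ℤ → ℂ) (n : ℤ × ℤ) (g : NN m) :
    (twistedWeyl m b).first ψ n g
      = (weyl m).first ψ n g - (b * ψ m) • Xop m (m + n) (XmZ m (-1) g) := by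
  rw [twistedWeyl, WeylFamily.twist_first_apply, LinearMap.smul_apply, map_smul, smul_smul,
    mul_neg, neg_smul, ← sub_eq_add_neg, mul_comm]
  rfl

lemma Xop_self_XmZ_neg_one (g : NN m) : Xop m m (XmZ m (-1) g) = g := by
  ext1 k
  rw [Xop_self_apply, XmZ_apply, sub_neg_eq_add, sub_add_cancel]

lemma XmZ_neg_one_Xop_self (g : NN m) : XmZ m (-1) (Xop m m g) = g := by
  ext1 k
  rw [XmZ_apply, Xop_self_apply, sub_neg_eq_add, add_sub_cancel_right]

lemma tE22_eq (q b : ℂ) (n : ℤ × ℤ) (g : NN m) :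
    tE22 q m b n g = (twistedWeyl m b).first (fun s => q ^ (s.1 * n.2)) n g := by
  rw [tE22, twistedWeyl_first_apply, E22N_eq]

lemma tE11_eq (q μ b : ℂ) (n : ℤ × ℤ) (g : NN m) :
    tE11 q μ m b n g = (if n = 0 then μ • g else 0)
      - (twistedWeyl m b).first (fun s => q ^ (s.2 * n.1)) n g := by
  rw [tE11, twistedWeyl_first_apply, E11N_eq]
  abel

lemma tD1_eq (b : ℂ) (g : NN m) :
    tD1 m b g = (twistedWeyl m b).first (fun s => (s.1 : ℂ)) 0 g := by
  rw [tD1, twistedWeyl_first_apply, D1N_eq, add_zero, Xop_self_XmZ_neg_one]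

lemma tD2_eq (b : ℂ) (g : NN m) :
    tD2 m b g = (twistedWeyl m b).first (fun s => (s.2 : ℂ)) 0 g := by
  rw [tD2, twistedWeyl_first_apply, D2N_eq, add_zero, Xop_self_XmZ_neg_one]

lemma tE12_eq {q : ℂ} (hq : q ≠ 0) (μ b : ℂ) (n : ℤ × ℤ) (g : NN m) :
    tE12 q μ m b n g = (twistedWeyl m b).lower q μ n g := by
  have hZ : (weyl m).d m * ((-b) • XmZLin m (-1))
      = ((-b) • XmZLin m (-1)) * (weyl m).d m + b • XmZLin m (-2) := by
    rw [mul_smul_comm, smul_mul_assoc]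
    refine (congrArg _ (DopLin_self_mul_XmZLin (-1))).trans ?_
    rw [smul_add, smul_smul]
    norm_num
    rfl
  have hYY : ((-b) • XmZLin m (-1)) (((-b) • XmZLin m (-1)) g) - (b • XmZLin m (-2)) g
      = (b * (b - 1)) • XmZ m (-1) (XmZ m (-1) g) := by
    have : XmZLin m (-2) g = XmZ m (-1) (XmZ m (-1) g) := by
      rw [show (-2 : ℤ) = -1 + -1 by norm_num, ← XmZLin_mul_XmZLin]
      rfl
    rw [LinearMap.smul_apply, LinearMap.smul_apply, LinearMap.smul_apply, map_smul, this]
    simp only [XmZLin_apply]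
    module
  have e1 : ∀ s : ℤ × ℤ, q ^ (n.2 * m.1 + s.2 * n.1 + s.2 * m.1)
      = q ^ (m.1 * n.2) * q ^ (s.2 * (m + n).1) := fun s => by
    rw [← zpow_add₀ hq, Prod.fst_add]; congr 1; ring
  have e2 : ∀ s : ℤ × ℤ, q ^ (n.2 * s.1 + m.2 * n.1 + m.2 * s.1)
      = q ^ (m.2 * n.1) * q ^ (s.1 * (m + n).2) := fun s => by
    rw [← zpow_add₀ hq, Prod.snd_add]; congr 1; ring
  have hfirst : ∀ (c : ℂ) (ψ : ℤ × ℤ → ℂ) (k : ℤ × ℤ) (v : NN m),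
      (weyl m).first (fun s => c * ψ s) k v = c • (weyl m).first ψ k v := fun c ψ k v => by
    rw [(weyl m).first_apply _ _ fun s => weyl_d_eq_zero,
      (weyl m).first_apply _ _ fun s => weyl_d_eq_zero, Finset.smul_sum]
    simp only [mul_smul]
  rw [tE12, E12N_eq, E22N_eq, E11N_eq, WeylFamily.lower_apply, WeylFamily.lower_apply, twistedWeyl,
    WeylFamily.twist_quad_apply _ _ _ _ _ _ _ hZ, hYY, WeylFamily.twist_d_apply]
  simp only [e1, e2, hfirst, LinearMap.smul_apply, map_smul, XmZLin_apply]
  have e3 : q ^ (m.1 * n.2) * q ^ (m.2 * (m + n).1)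
      = q ^ (m.2 * n.1 + m.2 * m.1 + m.1 * n.2) := by
    rw [← zpow_add₀ hq, Prod.fst_add]; congr 1; ring
  have e4 : (if -n = m then (-b) • XmZ m (-1) g else 0)
      = (-b) • if m + n = 0 then XmZ m (-1) g else 0 := by
    have : -n = m ↔ m + n = 0 := by rw [add_eq_zero_iff_neg_eq', ]
    simp only [this, smul_ite, smul_zero]
  have e5 : (if m + n = 0 then μ • XmZ m (-1) g else 0)
      = μ • if m + n = 0 then XmZ m (-1) g else 0 := by
    simp only [smul_ite, smul_zero]
  have e6 : q ^ (m.1 * n.2) • (if m + n = 0 then XmZ m (-1) g else 0)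
      = q ^ (-(n.1 * n.2)) • (if m + n = 0 then XmZ m (-1) g else 0) := by
    split_ifs with h
    · rw [show m.1 = -n.1 from congrArg Prod.fst (eq_neg_of_add_eq_zero_left h), neg_mul]
    · simp
  rw [e4, e5, e3]
  generalize (if m + n = 0 then XmZ m (-1) g else 0) = δ at *
  linear_combination (norm := skip) (-(b * μ)) • e6
  simp only [show (weyl m).X = XopLin m from rfl, XopLin_apply]
  module

end Identify

lemma mem_maxGenEigenspace_zero {V : Type*} [AddCommGroup V] [Module ℂ V] (T : Module.End ℂ V)
    (v : V) : v ∈ T.maxGenEigenspace 0 ↔ ∃ j : ℕ, (T ^ j) v = 0 := by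
  rw [Module.End.mem_maxGenEigenspace, zero_smul, sub_zero]

lemma mem_maxGenEigenspace_zero_of_mul_eq {V : Type*} [AddCommGroup V] [Module ℂ V]
    {T Y Z : Module.End ℂ V} (h : T * Y = Y * T + Z)
    (hZ : ∀ g ∈ T.maxGenEigenspace 0, Z g ∈ T.maxGenEigenspace 0) {g : V}
    (hg : g ∈ T.maxGenEigenspace 0) : Y g ∈ T.maxGenEigenspace 0 := by
  have mem := mem_maxGenEigenspace_zero T
  obtain ⟨j, hj⟩ := (mem g).mp hg
  induction j generalizing g with
  | zero =>
    obtain rfl : g = 0 := hj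
    rw [map_zero]; exact zero_mem _
  | succ j ih =>
    rw [pow_succ, Module.End.mul_apply] at hj
    have h1 : T (Y g) ∈ T.maxGenEigenspace 0 := by
      rw [show T (Y g) = Y (T g) + Z g from LinearMap.congr_fun h g]
      exact add_mem (ih ((mem _).mpr ⟨j, hj⟩) hj) (hZ g hg)
    obtain ⟨i, hi⟩ := (mem _).mp h1
    exact (mem _).mpr ⟨i + 1, by rwa [pow_succ, Module.End.mul_apply]⟩

namespace WeylFamily

section Invariant

variable {V : Type*} [AddCommGroup V] [Module ℂ V] (w : WeylFamily V) {q : ℂ} (hq : q ≠ 0)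
  (μ : ℂ) (a : ℤ × ℤ) {g : V}

include hq

lemma lower_mem_maxGenEigenspace (n : ℤ × ℤ)
    (hg : g ∈ (w.lower q μ a).maxGenEigenspace 0) :
    w.lower q μ n g ∈ (w.lower q μ a).maxGenEigenspace 0 :=
  mem_maxGenEigenspace_zero_of_mul_eq (Z := 0) (by rw [add_zero, w.lower_comm hq])
    (fun _ _ => zero_mem _) hg

lemma first_mem_maxGenEigenspace {ψ : ℤ × ℤ → ℂ} {n : ℤ × ℤ} {c : ℂ}
    (h : w.first ψ n * w.lower q μ a = w.lower q μ a * w.first ψ n - c • w.lower q μ (n + a))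
    (hg : g ∈ (w.lower q μ a).maxGenEigenspace 0) :
    w.first ψ n g ∈ (w.lower q μ a).maxGenEigenspace 0 :=
  mem_maxGenEigenspace_zero_of_mul_eq (Z := c • w.lower q μ (n + a)) (by rw [h, sub_add_cancel])
    (fun _ hv => Submodule.smul_mem _ _ (w.lower_mem_maxGenEigenspace hq μ a _ hv)) hg

lemma first_fst_mem_maxGenEigenspace (n : ℤ × ℤ)
    (hg : g ∈ (w.lower q μ a).maxGenEigenspace 0) :
    w.first (fun s => q ^ (s.1 * n.2)) n g ∈ (w.lower q μ a).maxGenEigenspace 0 := by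
  refine w.first_mem_maxGenEigenspace hq μ a
    (w.first_mul_lower μ _ n a (q ^ (a.2 * n.1)) ?_ fun s r => ?_) hg
  · rw [← zpow_add₀ hq, ← zpow_add₀ hq]
    congr 1
    simp only [Prod.fst_add, Prod.snd_add, Prod.fst_sub, Prod.fst_neg]
    ring
  · simp only [← zpow_add₀ hq, Prod.fst_add, Prod.snd_add]
    ring_nf

lemma first_snd_mem_maxGenEigenspace (n : ℤ × ℤ)
    (hg : g ∈ (w.lower q μ a).maxGenEigenspace 0) :
    w.first (fun s => q ^ (s.2 * n.1)) n g ∈ (w.lower q μ a).maxGenEigenspace 0 := by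
  refine w.first_mem_maxGenEigenspace hq μ a
    (w.first_mul_lower μ _ n a (q ^ (n.2 * a.1)) ?_ fun s r => ?_) hg
  · rw [← zpow_add₀ hq, ← zpow_add₀ hq]
    congr 1
    simp only [Prod.fst_add, Prod.snd_add, Prod.snd_sub, Prod.snd_neg]
    ring
  · simp only [← zpow_add₀ hq, Prod.fst_add, Prod.snd_add]
    ring_nf

lemma first_mem_maxGenEigenspace_of_additive (ψ : ℤ × ℤ →+ ℂ)
    (hg : g ∈ (w.lower q μ a).maxGenEigenspace 0) :
    w.first ψ 0 g ∈ (w.lower q μ a).maxGenEigenspace 0 := by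
  refine w.first_mem_maxGenEigenspace hq μ a
    (w.first_mul_lower μ _ 0 a (-ψ a) ?_ fun s r => ?_) hg
  · simp only [sub_zero, map_neg, zero_add]
    ring
  · simp only [map_add, zero_add]
    ring

lemma X_mem_maxGenEigenspace (k : ℤ × ℤ)
    (hg : g ∈ (w.lower q μ a).maxGenEigenspace 0) :
    w.X k g ∈ (w.lower q μ a).maxGenEigenspace 0 := by
  have h := w.lower_mul_X hq μ a k
  rw [add_sub_assoc, add_sub_assoc, ← sub_add_eq_sub_sub] at h
  refine mem_maxGenEigenspace_zero_of_mul_eq h (fun v hv => ?_) hg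
  refine sub_mem ?_ (add_mem (Submodule.smul_mem _ _ (w.first_snd_mem_maxGenEigenspace hq μ a _ hv))
    (Submodule.smul_mem _ _ (w.first_fst_mem_maxGenEigenspace hq μ a _ hv)))
  split_ifs
  exacts [Submodule.smul_mem _ _ hv, zero_mem _]

end Invariant

end WeylFamily

section Reducible

variable {m : ℤ × ℤ}

lemma Dop_single_of_ne {s : ℤ × ℤ} (hs : s ≠ m) (k : ℤ) (c : ℂ) :
    Dop m s (single k (C c)) = 0 := by
  ext1 i
  rw [Dop_apply hs, Finsupp.zero_apply, Finsupp.single_apply]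
  split_ifs
  · exact pderiv_C
  · exact map_zero _

lemma XmZ_single (j k : ℤ) (p : MvPolynomial (NVar m) ℂ) :
    XmZ m j (single k p) = single (k + j) p :=
  Finsupp.mapDomain_single

lemma Xop_self_single (k : ℤ) (p : MvPolynomial (NVar m) ℂ) :
    Xop m m (single k p) = single (k + 1) p := by
  rw [Xop, dif_pos rfl, XmZ_single]

lemma Dop_self_single (k : ℤ) (p : MvPolynomial (NVar m) ℂ) :
    Dop m m (single k p) = single (k - 1) (k • p) := by
  rw [Dop, dif_pos rfl, Finsupp.sum_single_index]
  rw [smul_zero, Finsupp.single_zero]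

lemma twistedWeyl_d_self_single (b : ℂ) (k : ℤ) (p : MvPolynomial (NVar m) ℂ) :
    (twistedWeyl m b).d m (single k p) = ((k : ℂ) - b) • single (k - 1) p := by
  rw [twistedWeyl_d_self, Dop_self_single, XmZ_single, sub_smul, ← sub_eq_add_neg,
    Int.cast_smul_eq_zsmul, Finsupp.smul_single, Finsupp.smul_single]

lemma twistedWeyl_d_single_of_ne (b : ℂ) {s : ℤ × ℤ} (hs : s ≠ m) (k : ℤ) (c : ℂ) :
    (twistedWeyl m b).d s (single k (C c)) = 0 := by
  rw [twistedWeyl_d_of_ne b hs, Dop_single_of_ne hs]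

lemma twistedWeyl_lower_single (q μ b : ℂ) (k : ℤ) (c : ℂ) :
    (twistedWeyl m b).lower q μ (-m) (single k (C c))
      = (q ^ (-(m.1 * m.2)) * ((k - b) * (b + μ + 1 - k))) • single (k - 1) (C c) := by
  have hS : ∀ s, s ∉ ({m} : Finset (ℤ × ℤ)) →
      (twistedWeyl m b).d s (single k (C c)) = 0 := fun s hs =>
    twistedWeyl_d_single_of_ne b (by simpa using hs) k c
  have e : (-m).2 * m.1 + m.2 * (-m).1 + m.2 * m.1 = -(m.1 * m.2) := by
    rw [Prod.fst_neg, Prod.snd_neg]; ring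
  rw [WeylFamily.lower_apply, WeylFamily.quad_apply _ _ _ hS, Finset.sum_singleton,
    Finset.sum_singleton, e, neg_neg, neg_add_cancel, zero_add, twistedWeyl_d_self_single, map_smul,
    map_smul, twistedWeyl_d_self_single, map_smul, twistedWeyl_X_apply, Xop_self_single,
    Prod.fst_neg, Prod.snd_neg, neg_mul_neg, sub_add_cancel]
  push_cast
  module

lemma exists_pow_lower_single {q : ℂ} (hq : q ≠ 0) {μ b : ℂ} (hb : ∀ z : ℤ, b ≠ (z : ℂ)) {z : ℤ}
    (hz : b + μ = z) (j : ℕ) : ∃ c : ℂ, c ≠ 0 ∧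
      ((twistedWeyl m b).lower q μ (-m) ^ j) (single z (C 1)) = c • single (z - j) (C 1) := by
  induction j with
  | zero => exact ⟨1, one_ne_zero, by simp⟩
  | succ j ih =>
    obtain ⟨c, hc, h⟩ := ih
    refine ⟨_, ?_, by rw [pow_succ', Module.End.mul_apply, h, map_smul, twistedWeyl_lower_single,
      smul_smul, Nat.cast_succ, ← sub_sub]⟩
    refine mul_ne_zero hc (mul_ne_zero (zpow_ne_zero _ hq) (mul_ne_zero ?_ ?_))
    · exact sub_ne_zero.mpr (hb _).symm
    · rw [hz]
      push_cast
      rw [show (z : ℂ) + 1 - (z - j) = (j : ℂ) + 1 by ring]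
      exact Nat.cast_add_one_ne_zero j

lemma exists_invariant_submodule {q μ b : ℂ} (hq : q ≠ 0) (hb : ∀ z : ℤ, b ≠ (z : ℂ)) {z : ℤ}
    (hz : b + μ = z) : ∃ W : Submodule ℂ (NN m),
      (∀ (n : ℤ × ℤ) (g : NN m), g ∈ W →
        tE11 q μ m b n g ∈ W ∧ tE12 q μ m b n g ∈ W ∧
        E21N m n g ∈ W ∧ tE22 q m b n g ∈ W) ∧
      (∀ g ∈ W, tD1 m b g ∈ W ∧ tD2 m b g ∈ W) ∧ W ≠ ⊥ ∧ W ≠ ⊤ := by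
  let w := twistedWeyl m b
  have mem := mem_maxGenEigenspace_zero (w.lower q μ (-m))
  refine ⟨(w.lower q μ (-m)).maxGenEigenspace 0, fun n g hg => ⟨?_, ?_, ?_, ?_⟩,
    fun g hg => ⟨?_, ?_⟩, fun h => ?_, fun h => ?_⟩
  · rw [tE11_eq]
    refine sub_mem ?_ (w.first_snd_mem_maxGenEigenspace hq μ _ n hg)
    split_ifs
    exacts [Submodule.smul_mem _ _ hg, zero_mem _]
  · rw [tE12_eq hq]
    exact w.lower_mem_maxGenEigenspace hq μ _ n hg
  · exact w.X_mem_maxGenEigenspace hq μ _ n hg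
  · rw [tE22_eq]
    exact w.first_fst_mem_maxGenEigenspace hq μ _ n hg
  · rw [tD1_eq]
    exact w.first_mem_maxGenEigenspace_of_additive hq μ _
      ((Int.castAddHom ℂ).comp (AddMonoidHom.fst ℤ ℤ)) hg
  · rw [tD2_eq]
    exact w.first_mem_maxGenEigenspace_of_additive hq μ _
      ((Int.castAddHom ℂ).comp (AddMonoidHom.snd ℤ ℤ)) hg
  · have : (single (z + 1) (C 1) : NN m) ∈ (w.lower q μ (-m)).maxGenEigenspace 0 := by
      refine (mem _).mpr ⟨1, ?_⟩
      rw [pow_one, twistedWeyl_lower_single, hz]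
      push_cast
      rw [sub_self, mul_zero, mul_zero, zero_smul]
    rw [h, Submodule.mem_bot, Finsupp.single_eq_zero] at this
    simp at this
  · obtain ⟨j, hj⟩ := (mem (single z (C 1))).mp (h ▸ Submodule.mem_top)
    obtain ⟨c, hc, hcj⟩ := exists_pow_lower_single (m := m) hq hb hz j
    rw [hcj] at hj
    have := (smul_eq_zero.mp hj).resolve_left hc
    rw [Finsupp.single_eq_zero] at this
    simp at this

end Reducible

lemma mem_of_sum_eigenvectors_mem {ι K V : Type*} [Field K] [AddCommGroup V] [Module K V]
    {T : Module.End K V} {W : Submodule K V} (hT : ∀ v ∈ W, T v ∈ W) {c : ι → K}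
    (hc : Function.Injective c) (S : Finset ι) {v : ι → V} (hv : ∀ i ∈ S, T (v i) = c i • v i)
    (h : ∑ i ∈ S, v i ∈ W) : ∀ i ∈ S, v i ∈ W := by
  classical
  induction S using Finset.induction_on generalizing v with
  | empty => simp
  | insert a S ha ih =>
    rw [Finset.forall_mem_insert] at hv
    have h1 : ∑ i ∈ S, (c i - c a) • v i ∈ W := by
      have := sub_mem (hT _ h) (W.smul_mem (c a) h)
      rw [Finset.sum_insert ha, map_add, hv.1, map_sum, smul_add, add_sub_add_left_eq_sub,
        Finset.smul_sum, ← Finset.sum_sub_distrib] at this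
      convert this using 2 with i hi
      rw [hv.2 i hi, sub_smul]
    have h2 : ∀ i ∈ S, v i ∈ W := fun i hi => by
      have := ih (v := fun i => (c i - c a) • v i)
        (fun i hi => by rw [map_smul, hv.2 i hi, smul_comm]) h1 i hi
      exact (W.smul_mem_iff (sub_ne_zero.mpr (hc.ne (by rintro rfl; exact ha hi)))).mp this
    rw [Finset.forall_mem_insert]
    refine ⟨?_, h2⟩
    rw [Finset.sum_insert ha] at h
    exact (Submodule.add_mem_iff_left W (sum_mem h2)).mp h

namespace WeylFamily

section Irreducible

variable {V : Type*} [AddCommGroup V] [Module ℂ V] (w : WeylFamily V) {q μ : ℂ} {m : ℤ × ℤ}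
  {W : Submodule ℂ V}

lemma mem_of_X_mem_of_euler_eq (hq : q ≠ 0) {Y : Module.End ℂ V} (hY : ∀ v, Y (w.X m v) = v)
    (hX : ∀ v ∈ W, w.X m v ∈ W) (hL : ∀ v ∈ W, w.lower q μ (-m) v ∈ W) {α : ℂ}
    (hα : ∀ D : ℕ, (α - D) * (μ - α - D + 1) ≠ 0) {D : ℕ} {f : V} (hf : f ∈ W)
    (hE : w.euler f = α • f) (hD : f ∈ w.fil {m}ᶜ D) : Y f ∈ W := by
  induction D generalizing f with
  | zero =>
    obtain rfl := w.mem_fil_zero.mp hD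
    simp
  | succ D ih =>
    set c := q ^ (-(m.1 * m.2)) * ((α - D) * (μ - α - D + 1))
    have hc : c ≠ 0 := mul_ne_zero (zpow_ne_zero _ hq) (hα D)
    have hE' : w.euler (w.X m (w.lower q μ (-m) f)) = α • w.X m (w.lower q μ (-m) f) := by
      have h1 := LinearMap.congr_fun (w.euler_mul_X m) (w.lower q μ (-m) f)
      have h2 := LinearMap.congr_fun (w.euler_mul_lower q μ (-m)) f
      simp only [Module.End.mul_apply, LinearMap.add_apply, LinearMap.sub_apply] at h1 h2
      rw [h1, h2, hE, map_sub, sub_add_cancel, map_smul, map_smul]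
    have := ih (sub_mem (hX _ (hL f hf)) (W.smul_mem c hf))
      (by rw [map_sub, hE', map_smul, hE, smul_sub, smul_comm]) (w.X_lower_sub_mem_fil q μ m D α hD hE)
    rw [map_sub, hY, map_smul] at this
    exact (W.smul_mem_iff hc).mp ((Submodule.sub_mem_iff_right W (hL f hf)).mp this)

lemma exists_ne_zero_d_eq_zero (hq : q ≠ 0) (hμ : μ ≠ 0) (hL : ∀ n, ∀ v ∈ W, w.lower q μ n v ∈ W)
    {D : ℕ} {v : V} (hv : v ∈ W) (h0 : v ≠ 0) (hD : v ∈ w.fil Set.univ D) :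
    ∃ g ∈ W, g ≠ 0 ∧ ∀ s, w.d s g = 0 := by
  induction D generalizing v with
  | zero => exact absurd (w.mem_fil_zero.mp hD) h0
  | succ D ih =>
    by_cases h : ∀ n, w.lower q μ n v = 0
    · exact ⟨v, hv, h0, w.d_eq_zero_of_lower_eq_zero hq hμ h⟩
    · obtain ⟨n, hn⟩ := not_forall.mp h
      exact ih (hL n v hv) hn (w.lower_mem_fil q μ n hD)

end Irreducible

end WeylFamily

section Irreducible

variable {m : ℤ × ℤ}

lemma NN_induction {p : NN m → Prop} (add : ∀ f g, p f → p g → p (f + g))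
    (base : ∀ (k : ℤ) (c : ℂ), p (single k (C c))) (mul : ∀ s, s ≠ m → ∀ f, p f → p (Xop m s f))
    (f : NN m) : p f := by
  have zero : p 0 := by simpa using base 0 0
  induction f using Finsupp.induction_linear with
  | zero => exact zero
  | add f g hf hg => exact add f g hf hg
  | single k a =>
    induction a using MvPolynomial.induction_on with
    | C c => exact base k c
    | add a b ha hb => rw [Finsupp.single_add]; exact add _ _ ha hb
    | mul_X a i ha =>
      have : (single k (a * X i) : NN m) = Xop m i (single k a) := by
        ext1 l
        rw [Xop_apply i.2, Finsupp.single_apply, Finsupp.single_apply]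
        split_ifs
        · exact mul_comm _ _
        · rw [mul_zero]
      rw [this]
      exact mul _ i.2 _ ha

lemma exists_mem_fil (b : ℂ) (f : NN m) : ∃ D, f ∈ (twistedWeyl m b).fil {m}ᶜ D := by
  induction f using NN_induction with
  | add f g hf hg =>
    obtain ⟨D, hD⟩ := hf
    obtain ⟨E, hE⟩ := hg
    exact ⟨max D E, add_mem ((twistedWeyl m b).fil_mono (le_max_left _ _) hD)
      ((twistedWeyl m b).fil_mono (le_max_right _ _) hE)⟩
  | base k c =>
    refine ⟨1, (twistedWeyl m b).mem_fil_succ.mpr fun s hs => ?_⟩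
    rw [twistedWeyl_d_single_of_ne b hs]
    exact zero_mem _
  | mul s hs f hf =>
    obtain ⟨D, hD⟩ := hf
    exact ⟨D + 1, (twistedWeyl m b).X_mem_fil s hD⟩

lemma euler_single (b : ℂ) (k : ℤ) (c : ℂ) :
    (twistedWeyl m b).euler (single k (C c)) = ((k : ℂ) - b) • single k (C c) := by
  have hS : ∀ s, s ∉ ({m} : Finset (ℤ × ℤ)) →
      (twistedWeyl m b).d s (single k (C c)) = 0 := fun s hs =>
    twistedWeyl_d_single_of_ne b (by simpa using hs) k c
  rw [WeylFamily.euler, WeylFamily.first_apply _ _ _ hS, Finset.sum_singleton, one_smul, zero_add,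
    twistedWeyl_d_self_single, map_smul, twistedWeyl_X_apply, Xop_self_single, sub_add_cancel]

lemma mem_iSup_eigenspace_euler (b : ℂ) (f : NN m) :
    f ∈ ⨆ t : ℤ, (twistedWeyl m b).euler.eigenspace (t - b) := by
  induction f using NN_induction with
  | add f g hf hg => exact add_mem hf hg
  | base k c =>
    exact Submodule.mem_iSup_of_mem k (Module.End.mem_eigenspace_iff.mpr (euler_single b k c))
  | mul s hs f hf =>
    have : (⨆ t : ℤ, (twistedWeyl m b).euler.eigenspace (t - b)) ≤
        (⨆ t : ℤ, (twistedWeyl m b).euler.eigenspace (t - b)).comap ((twistedWeyl m b).X s) := by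
      refine iSup_le fun t g hg => Submodule.mem_iSup_of_mem (t + 1) ?_
      rw [Module.End.mem_eigenspace_iff] at hg ⊢
      refine (LinearMap.congr_fun ((twistedWeyl m b).euler_mul_X s) g).trans ?_
      change (twistedWeyl m b).X s ((twistedWeyl m b).euler g) + (twistedWeyl m b).X s g = _
      rw [hg, map_smul]
      push_cast
      module
    exact this hf

lemma XmZ_neg_one_mem {q μ b : ℂ} (hq : q ≠ 0) (hb : ∀ z : ℤ, b ≠ z) (hbμ : ∀ z : ℤ, b + μ ≠ z)
    {W : Submodule ℂ (NN m)} (hX : ∀ g ∈ W, Xop m m g ∈ W)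
    (hL : ∀ g ∈ W, (twistedWeyl m b).lower q μ (-m) g ∈ W)
    (hE : ∀ g ∈ W, (twistedWeyl m b).euler g ∈ W) {g : NN m} (hg : g ∈ W) : XmZ m (-1) g ∈ W := by
  obtain ⟨v, hv, rfl⟩ := (Submodule.mem_iSup_iff_exists_finsupp _ _).mp
    (mem_iSup_eigenspace_euler b g)
  have hv' : ∀ t : ℤ, (twistedWeyl m b).euler (v t) = ((t : ℂ) - b) • v t := fun t =>
    Module.End.mem_eigenspace_iff.mp (hv t)
  have hmem := mem_of_sum_eigenvectors_mem hE (c := fun t : ℤ => (t : ℂ) - b)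
    (fun s t h => Int.cast_injective (sub_left_injective h)) v.support (fun t _ => hv' t) hg
  change XmZLin m (-1) (∑ t ∈ v.support, v t) ∈ W
  rw [map_sum]
  refine sum_mem fun t ht => ?_
  obtain ⟨D, hD⟩ := exists_mem_fil b (v t)
  refine (twistedWeyl m b).mem_of_X_mem_of_euler_eq hq XmZ_neg_one_Xop_self hX hL
    (fun D => mul_ne_zero (fun h => hb (t - D) ?_) (fun h => hbμ (t + D - 1) ?_))
    (hmem t ht) (hv' t) hD
  · push_cast
    linear_combination -h
  · push_cast
    linear_combination h

lemma exists_pow_mem_fil (f : NN m) :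
    ∃ j D : ℕ, ((weyl m).X m ^ j) f ∈ (weyl m).fil Set.univ D := by
  have up : ∀ {f : NN m} {j D : ℕ} (i : ℕ), ((weyl m).X m ^ j) f ∈ (weyl m).fil Set.univ D →
      ((weyl m).X m ^ (i + j)) f ∈ (weyl m).fil Set.univ (i + D) := by
    intro f j D i h
    induction i with
    | zero => rwa [zero_add, zero_add]
    | succ i ih =>
      rw [add_right_comm i 1 j, pow_succ', add_right_comm i 1 D]
      exact (weyl m).X_mem_fil m ih
  induction f using NN_induction with
  | add f g hf hg =>
    obtain ⟨j, D, hD⟩ := hf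
    obtain ⟨i, E, hE⟩ := hg
    refine ⟨i + j, max (i + D) (j + E), ?_⟩
    rw [map_add]
    refine add_mem ((weyl m).fil_mono (le_max_left _ _) (up i hD))
      ((weyl m).fil_mono (le_max_right _ _) ?_)
    rw [add_comm i j]
    exact up j hE
  | base k c =>
    have h0 : (single 0 (C c) : NN m) ∈ (weyl m).fil Set.univ 1 := by
      refine (weyl m).mem_fil_succ.mpr fun s _ => ?_
      change Dop m s _ = 0
      by_cases hs : s = m
      · rw [hs, Dop_self_single, zero_smul, Finsupp.single_zero]
      · rw [Dop_single_of_ne hs]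
    have hpow : ∀ (i : ℕ) (l : ℤ), ((weyl m).X m ^ i) (single l (C c)) = single (l + i) (C c) := by
      intro i l
      induction i with
      | zero => simp
      | succ i ih =>
        rw [pow_succ', Module.End.mul_apply, ih]
        refine (Xop_self_single _ _).trans ?_
        push_cast
        rw [add_assoc]
    refine ⟨k.natAbs, (k + k.natAbs).toNat + 1, ?_⟩
    have := up (j := 0) (k + k.natAbs).toNat (f := single 0 (C c)) (D := 1) (by simpa using h0)
    rwa [add_zero, hpow, zero_add, Int.toNat_of_nonneg (by omega), ← hpow] at this
  | mul s hs f hf =>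
    obtain ⟨j, D, hD⟩ := hf
    refine ⟨j, D + 1, ?_⟩
    have h : Commute ((weyl m).X m ^ j) ((weyl m).X s) :=
      Commute.pow_left ((weyl m).X_comm m s) j
    rw [show ((weyl m).X m ^ j) (Xop m s f) = (weyl m).X s (((weyl m).X m ^ j) f) from
      LinearMap.congr_fun h.eq f]
    exact (weyl m).X_mem_fil s hD

lemma pow_X_self_apply_ne_zero {f : NN m} (hf : f ≠ 0) (j : ℕ) : ((weyl m).X m ^ j) f ≠ 0 := by
  induction j with
  | zero => exact hf
  | succ j ih =>
    rw [pow_succ', Module.End.mul_apply]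
    intro h
    refine ih ?_
    rw [← XmZ_neg_one_Xop_self (((weyl m).X m ^ j) f)]
    exact (congrArg (XmZ m (-1)) h).trans (XmZLin m (-1)).map_zero

lemma eq_single_of_Dop_eq_zero {g : NN m} (h : ∀ s, Dop m s g = 0) : ∃ c, g = single 0 (C c) := by
  refine ⟨coeff 0 (g 0), Finsupp.ext fun k => ?_⟩
  rw [Finsupp.single_apply]
  split_ifs with hk
  · subst hk
    ext e
    rw [coeff_C]
    split_ifs with he
    · rw [he]
    · obtain ⟨i, hi⟩ := Finsupp.ne_iff.mp (Ne.symm he)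
      have h1 := congrArg (coeff (e - single i 1)) (DFunLike.congr_fun (h i) 0)
      rw [Dop_apply i.2] at h1
      rw [show pderiv (⟨i, i.2⟩ : NVar m) = pderiv i from rfl, coeff_pderiv, tsub_add_cancel_of_le,
        Finsupp.zero_apply, coeff_zero] at h1
      · exact (mul_eq_zero.mp h1).resolve_right (Nat.cast_add_one_ne_zero _)
      · exact Finsupp.single_le_iff.mpr (Nat.one_le_iff_ne_zero.mpr hi)
  · have h1 := DFunLike.congr_fun (h m) (k - 1)
    rw [Dop_self_apply, sub_add_cancel, Finsupp.zero_apply] at h1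
    exact (smul_eq_zero.mp h1).resolve_left (Ne.symm hk)

lemma eq_top_of_single_mem {W : Submodule ℂ (NN m)} (hX : ∀ k, ∀ g ∈ W, Xop m k g ∈ W)
    (hY : ∀ g ∈ W, XmZ m (-1) g ∈ W) {c : ℂ} (hc : c ≠ 0) (h : (single 0 (C c) : NN m) ∈ W) :
    W = ⊤ := by
  refine Submodule.eq_top_iff'.mpr fun f => ?_
  induction f using NN_induction with
  | add f g hf hg => exact add_mem hf hg
  | base k a =>
    have hk : (single k (C c) : NN m) ∈ W := by
      induction k using Int.induction_on with
      | zero => exact h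
      | succ k ih => rw [← Xop_self_single]; exact hX m _ ih
      | pred k ih => rw [sub_eq_add_neg, ← XmZ_single]; exact hY _ ih
    have := W.smul_mem (a / c) hk
    rwa [Finsupp.smul_single, smul_eq_C_mul, ← C_mul, div_mul_cancel₀ a hc] at this
  | mul s hs f hf => exact hX s f hf

lemma eq_top_of_invariant {q μ b : ℂ} (hq : q ≠ 0) (hμ : μ ≠ 0) (hb : ∀ z : ℤ, b ≠ z)
    (hbμ : ∀ z : ℤ, b + μ ≠ z) {W : Submodule ℂ (NN m)} (h11 : ∀ n, ∀ g ∈ W, tE11 q μ m b n g ∈ W)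
    (h12 : ∀ n, ∀ g ∈ W, tE12 q μ m b n g ∈ W) (h21 : ∀ n, ∀ g ∈ W, E21N m n g ∈ W)
    (h22 : ∀ n, ∀ g ∈ W, tE22 q m b n g ∈ W) (hW : W ≠ ⊥) : W = ⊤ := by
  have hY : ∀ g ∈ W, XmZ m (-1) g ∈ W := fun g hg => by
    refine XmZ_neg_one_mem hq hb hbμ (h21 m) (fun g hg => ?_) (fun g hg => ?_) hg
    · rw [← tE12_eq hq]
      exact h12 (-m) g hg
    · have := h22 0 g hg
      rw [tE22_eq] at this
      simpa only [WeylFamily.euler, Prod.snd_zero, mul_zero, zpow_zero] using this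
  have h11' : ∀ n, ∀ g ∈ W, E11N q μ m n g ∈ W := fun n g hg =>
    (W.add_mem_iff_left (W.smul_mem _ (h21 _ _ (hY g hg)))).mp (h11 n g hg)
  have h22' : ∀ n, ∀ g ∈ W, E22N q m n g ∈ W := fun n g hg =>
    (W.sub_mem_iff_left (W.smul_mem _ (h21 _ _ (hY g hg)))).mp (h22 n g hg)
  have h12' : ∀ n, ∀ g ∈ W, (weyl m).lower q μ n g ∈ W := fun n g hg => by
    rw [← E12N_eq]
    refine (W.add_mem_iff_left (W.smul_mem b (sub_mem (W.smul_mem _ (h22' _ _ (hY g hg)))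
      (W.smul_mem _ (h11' _ _ (hY g hg)))))).mp
      ((W.sub_mem_iff_left (W.smul_mem _ (h21 _ _ (hY _ (hY g hg))))).mp (h12 n g hg))
  obtain ⟨f, hf, hf0⟩ := W.exists_mem_ne_zero_of_ne_bot hW
  obtain ⟨j, D, hD⟩ := exists_pow_mem_fil f
  have hj : ∀ j : ℕ, ((weyl m).X m ^ j) f ∈ W := fun j => by
    induction j with
    | zero => exact hf
    | succ j ih => rw [pow_succ']; exact h21 m _ ih
  obtain ⟨g, hg, hg0, hd⟩ := (weyl m).exists_ne_zero_d_eq_zero hq hμ h12' (hj j)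
    (pow_X_self_apply_ne_zero hf0 j) hD
  obtain ⟨c, rfl⟩ := eq_single_of_Dop_eq_zero hd
  refine eq_top_of_single_mem h21 hY (c := c) ?_ hg
  rintro rfl
  exact hg0 (by rw [C_0, Finsupp.single_zero])

end Irreducible

/-- for `b ∉ ℤ` (and `μ ≠ 0`, so that `P` is irreducible), the twisted
module `𝒟_m^b M` — i.e. `N` with the `b`-twisted operators — is irreducible iff
`b + μ ∉ ℤ`. -/
theorem stmt19 (q μ : ℂ) (hq : q ≠ 0) (hμ : μ ≠ 0) (m : ℤ × ℤ) (b : ℂ)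
    (hb : ∀ z : ℤ, b ≠ (z : ℂ)) :
    (∀ W : Submodule ℂ (NN m),
      (∀ (n : ℤ × ℤ) (g : NN m), g ∈ W →
        tE11 q μ m b n g ∈ W ∧ tE12 q μ m b n g ∈ W ∧
        E21N m n g ∈ W ∧ tE22 q m b n g ∈ W) →
      (∀ g ∈ W, tD1 m b g ∈ W ∧ tD2 m b g ∈ W) →
      W = ⊥ ∨ W = ⊤) ↔ (∀ z : ℤ, b + μ ≠ (z : ℂ)) := by
  constructor
  · intro h z hz
    obtain ⟨W, h1, h2, h3, h4⟩ := exists_invariant_submodule (m := m) hq hb hz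
    exact (h W h1 h2).elim h3 h4
  · intro hbμ W h1 _
    refine or_iff_not_imp_left.mpr (eq_top_of_invariant hq hμ hb hbμ (fun n g hg => (h1 n g hg).1)
      (fun n g hg => (h1 n g hg).2.1) (fun n g hg => (h1 n g hg).2.2.1)
      (fun n g hg => (h1 n g hg).2.2.2))
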